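/- arXiv:2410.17447 — 2 statements merged into one kernel-verified Lean document; each statement's English description precedes it below -/
import Mathlib

section
/- Let (p_{i_0,…,i_k}) be the unique solution of the limiting degree recursion and φ(x_0,…,x_k) := Σ_{1≤i_k<⋯<i_0} p_{i_0,…,i_k} Π_{ℓ=0}^{k} x_ℓ^{i_ℓ} its joint probability generating function. Then for all x_0,…,x_k ∈ [0,1], φ(x_0,…,x_k) = Π_{m=0}^{k} x_m^{k−m+1} ∫_1^∞ (τ/b_0) z^{−(1+τ/b_0)} (x_0(1−z)+z)^{−(1+δ)/b_0} Π_{m=1}^{k} H_m(x_0,…,x_m,z)^{−(1+δ)/b_m} dz, where the functions H_m are defined recursively by H_1(x_0,x_1,z) = (1−x_1)z^{b_1/b_0} + x_1(x_0+z(1−x_0))^{b_1/b_0} and H_m(x_0,…,x_m,z) = (1−x_m)z^{b_m/b_0} + x_m H_{m-1}(x_0,…,x_{m-1},z)^{b_m/b_{m-1}} for m = 2,…,k. -/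
open MeasureTheory Filter Finset

noncomputable section

/-- The coefficient `b_m = k - m + 1 + δ(k - m)`. -/
def bcoef (k : ℕ) (δ : ℝ) (m : ℕ) : ℝ := (k : ℝ) - m + 1 + δ * ((k : ℝ) - m)

/-- The coefficient `τ = k + 2 + δ(k + 1)`. -/
def tauc (k : ℕ) (δ : ℝ) : ℝ := (k : ℝ) + 2 + δ * ((k : ℝ) + 1)

/-- A vector `(i_0, …, i_k)` of degrees is valid when `1 ≤ i_k < i_{k-1} < ⋯ < i_0`. -/
def ValidIdx (k : ℕ) (i : Fin (k + 1) → ℕ) : Prop :=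
  1 ≤ i (Fin.last k) ∧ StrictAnti i

/-- Decrease every coordinate of the index vector by one. -/
def allDec (k : ℕ) (i : Fin (k + 1) → ℕ) : Fin (k + 1) → ℕ := fun ℓ => i ℓ - 1

/-- Decrease the coordinates `0, …, m` of the index vector by one. -/
def decUpTo (k : ℕ) (m : ℕ) (i : Fin (k + 1) → ℕ) : Fin (k + 1) → ℕ :=
  fun ℓ => if (ℓ : ℕ) ≤ m then i ℓ - 1 else i ℓ

/-- The limiting degree recursion: `p` vanishes outside the valid index vectors, and on the
valid index vectors it satisfies the recursion of Theorem 2.1 of the paper. -/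
def LimitRecursion (k : ℕ) (δ : ℝ) (p : (Fin (k + 1) → ℕ) → ℝ) : Prop :=
  (∀ i, ¬ ValidIdx k i → p i = 0) ∧
  ∀ i, ValidIdx k i →
    p i = ((i (Fin.last k) : ℝ) - 1 + δ) / tauc k δ * p (allDec k i)
      + (∑ m : Fin k,
          (((i m.castSucc : ℝ) - 1 - k + (m : ℕ)) * bcoef k δ (m : ℕ)
            - ((i m.succ : ℝ) - k + (m : ℕ) + 1) * bcoef k δ ((m : ℕ) + 1)) / tauc k δ
            * p (decUpTo k (m : ℕ) i))
      - (((i 0 : ℝ) - k) * bcoef k δ 0 + δ) / tauc k δ * p i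
      + (if ∀ ℓ : Fin (k + 1), i ℓ = k - (ℓ : ℕ) + 1 then (1 : ℝ) else 0)

/-- The functions `H_m` of display (4.4) in the paper (with `H_0(x_0,z) = x_0 + z(1-x_0)`). -/
def Hfun (k : ℕ) (δ : ℝ) (x : ℕ → ℝ) (z : ℝ) : ℕ → ℝ
  | 0 => x 0 + z * (1 - x 0)
  | m + 1 => (1 - x (m + 1)) * z ^ (bcoef k δ (m + 1) / bcoef k δ 0)
      + x (m + 1) * Hfun k δ x z m ^ (bcoef k δ (m + 1) / bcoef k δ m)

/-- The functions `g_m`: `g_0(θ_0) = 1 + θ_0`,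
`g_{m+1}(θ_0,…,θ_{m+1}) = g_m(θ_0,…,θ_m)^{b_{m+1}/b_m} + θ_{m+1}`. -/
def gfun (k : ℕ) (δ : ℝ) (θ : ℕ → ℝ) : ℕ → ℝ
  | 0 => 1 + θ 0
  | m + 1 => gfun k δ θ m ^ (bcoef k δ (m + 1) / bcoef k δ m) + θ (m + 1)

/-- The joint probability generating function of the family `p`. -/
def pgfFun (k : ℕ) (p : (Fin (k + 1) → ℕ) → ℝ) (x : Fin (k + 1) → ℝ) : ℝ :=
  ∑' i : Fin (k + 1) → ℕ, p i * ∏ ℓ : Fin (k + 1), x ℓ ^ i ℓ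

/-- Extension of a vector `x : Fin (k+1) → ℝ` to a function on `ℕ` (by `0`). -/
def extVec (k : ℕ) (x : Fin (k + 1) → ℝ) : ℕ → ℝ :=
  fun j => if h : j < k + 1 then x ⟨j, h⟩ else 0

/-- Extension by `0` of an index vector to a function on `ℕ`. -/
def idxExt (k : ℕ) (i : Fin (k + 1) → ℕ) (m : ℕ) : ℕ := if h : m < k + 1 then i ⟨m, h⟩ else 0

/-- The rates `(i_m - k + m) b_m`; at `m = k + 1` this is `-δ`. -/
def idxRate (k : ℕ) (δ : ℝ) (i : Fin (k + 1) → ℕ) (m : ℕ) : ℝ :=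
  ((idxExt k i m : ℝ) - k + m) * bcoef k δ m

/-- Increase the coordinates `0, …, m` of the index vector by one. -/
def incUpTo (k m : ℕ) (i : Fin (k + 1) → ℕ) : Fin (k + 1) → ℕ :=
  fun ℓ => if (ℓ : ℕ) ≤ m then i ℓ + 1 else i ℓ

/-- The smallest valid index vector. -/
def minIdx (k : ℕ) : Fin (k + 1) → ℕ := fun ℓ => k - (ℓ : ℕ) + 1

lemma bcoef_pos {k : ℕ} {δ : ℝ} (hδ : -1 < δ) {m : ℕ} (hm : m ≤ k) : 0 < bcoef k δ m := by
  have : (m : ℝ) ≤ k := by exact_mod_cast hm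
  unfold bcoef
  nlinarith [mul_nonneg (sub_nonneg.2 this) (by linarith : 0 ≤ 1 + δ)]

lemma tauc_pos {k : ℕ} {δ : ℝ} (hδ : -1 < δ) : 0 < tauc k δ := by
  unfold tauc
  nlinarith [mul_nonneg (Nat.cast_nonneg (α := ℝ) k) (by linarith : 0 ≤ 1 + δ)]

lemma tauc_eq (k : ℕ) (δ : ℝ) : tauc k δ = bcoef k δ 0 + (1 + δ) := by
  unfold tauc bcoef
  push_cast
  ring

lemma idxExt_coe {k : ℕ} (i : Fin (k + 1) → ℕ) (ℓ : Fin (k + 1)) : idxExt k i ℓ = i ℓ :=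
  dif_pos ℓ.2

lemma idxRate_zero (k : ℕ) (δ : ℝ) (i : Fin (k + 1) → ℕ) :
    idxRate k δ i 0 = ((i 0 : ℝ) - k) * bcoef k δ 0 := by
  simp [idxRate, idxExt]

lemma idxRate_top (k : ℕ) (δ : ℝ) (i : Fin (k + 1) → ℕ) : idxRate k δ i (k + 1) = -δ := by
  simp [idxRate, idxExt, bcoef]

lemma incUpTo_injective (k m : ℕ) : Function.Injective (incUpTo k m) := by
  intro i j h
  funext ℓ
  have := congrFun h ℓ
  simp only [incUpTo] at this
  split_ifs at this <;> omega

lemma decUpTo_incUpTo (k m : ℕ) (i : Fin (k + 1) → ℕ) : decUpTo k m (incUpTo k m i) = i := by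
  funext ℓ
  simp only [incUpTo, decUpTo]
  split_ifs <;> omega

namespace ValidIdx

variable {k : ℕ} {i : Fin (k + 1) → ℕ}

lemma one_le (h : ValidIdx k i) (ℓ : Fin (k + 1)) : 1 ≤ i ℓ :=
  h.1.trans (h.2.antitone (Fin.le_last ℓ))

lemma minIdx_le_idxExt (h : ValidIdx k i) {m : ℕ} (hm : m ≤ k) : k - m + 1 ≤ idxExt k i m := by
  induction hn : k - m generalizing m with
  | zero =>
    have : m = k := by omega
    subst this
    simpa [idxExt, Fin.last] using h.1
  | succ n ih =>
    have := ih (m := m + 1) (by omega) (by omega)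
    have h2 : idxExt k i (m + 1) < idxExt k i m := by
      rw [idxExt, idxExt, dif_pos (by omega), dif_pos (by omega)]
      exact h.2 (by simp [Fin.lt_def])
    omega

lemma idxExt_succ_lt (h : ValidIdx k i) {m : ℕ} (hm : m ≤ k) :
    idxExt k i (m + 1) < idxExt k i m := by
  by_cases h' : m < k
  · rw [idxExt, idxExt, dif_pos (by omega), dif_pos (by omega)]
    exact h.2 (by simp [Fin.lt_def])
  · have := h.minIdx_le_idxExt hm
    rw [idxExt, dif_neg (by omega)]
    omega

lemma incUpTo (h : ValidIdx k i) (m : ℕ) : ValidIdx k (incUpTo k m i) := by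
  refine ⟨?_, fun a b hab => ?_⟩
  · have := h.1
    simp only [_root_.incUpTo]
    split_ifs <;> omega
  · have h1 := h.2 hab
    have h2 : (a : ℕ) < b := hab
    simp only [_root_.incUpTo]
    split_ifs <;> omega

lemma incUpTo_decUpTo (h : ValidIdx k i) (m : ℕ) : _root_.incUpTo k m (decUpTo k m i) = i := by
  funext ℓ
  have := h.one_le ℓ
  simp only [_root_.incUpTo, decUpTo]
  split_ifs <;> omega

lemma idxRate_succ_le (h : ValidIdx k i) {δ : ℝ} (hδ : -1 < δ) {m : ℕ} (hm : m ≤ k) :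
    idxRate k δ i (m + 1) ≤ idxRate k δ i m := by
  have h1 : (idxExt k i (m + 1) : ℝ) + 1 ≤ idxExt k i m := by
    exact_mod_cast h.idxExt_succ_lt hm
  have h2 : ((k - m + 1 : ℕ) : ℝ) ≤ idxExt k i m := by exact_mod_cast h.minIdx_le_idxExt hm
  push_cast [Nat.cast_sub hm] at h2
  have hb : bcoef k δ m = bcoef k δ (m + 1) + (1 + δ) := by
    unfold bcoef
    push_cast
    ring
  have h3 : 0 ≤ (idxExt k i m - k + m : ℝ) * (1 + δ) :=
    mul_nonneg (by linarith) (by linarith)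
  rcases hm.lt_or_eq with hm' | rfl
  · have hb' := bcoef_pos hδ (k := k) (m := m + 1) hm'
    unfold idxRate
    rw [hb]
    push_cast
    nlinarith [mul_nonneg (sub_nonneg.2 h1) hb'.le]
  · rw [idxRate_top]
    have hb0 : bcoef m δ m = 1 := by simp [bcoef]
    rw [idxRate, hb0]
    linarith

end ValidIdx

lemma minIdx_valid (k : ℕ) : ValidIdx k (minIdx k) := by
  refine ⟨by simp [minIdx], fun a b hab => ?_⟩
  have h2 : (a : ℕ) < b := hab
  simp only [minIdx]
  omega

namespace LimitRecursion

variable {k : ℕ} {δ : ℝ} {p : (Fin (k + 1) → ℕ) → ℝ}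

lemma rate_mul_eq (hδ : -1 < δ) (hp : LimitRecursion k δ p) {i : Fin (k + 1) → ℕ}
    (hi : ValidIdx k i) :
    (tauc k δ + idxRate k δ i 0 + δ) * p i
      = ∑ m ∈ range (k + 1), (idxRate k δ (decUpTo k m i) m - idxRate k δ (decUpTo k m i) (m + 1))
          * p (decUpTo k m i) + if i = minIdx k then tauc k δ else 0 := by
  have hτ := tauc_pos (k := k) hδ
  have h := hp.2 i hi
  have hb0 : bcoef k δ k = 1 := by simp [bcoef]
  have hall : allDec k i = decUpTo k k i := by
    funext ℓ
    have : (ℓ : ℕ) ≤ k := by omega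
    simp [allDec, decUpTo, this]
  have hlast : idxRate k δ (decUpTo k k i) k - idxRate k δ (decUpTo k k i) (k + 1)
      = (i (Fin.last k) : ℝ) - 1 + δ := by
    have h1 := hi.1
    rw [idxRate_top, idxRate, hb0, idxExt, dif_pos (by omega)]
    have : decUpTo k k i ⟨k, by omega⟩ = i (Fin.last k) - 1 := by simp [decUpTo, Fin.last]
    rw [this]
    push_cast [Nat.cast_sub h1]
    ring
  have hterm : ∀ m : Fin k, idxRate k δ (decUpTo k m i) m - idxRate k δ (decUpTo k m i) (m + 1)
      = ((i m.castSucc : ℝ) - 1 - k + (m : ℕ)) * bcoef k δ (m : ℕ)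
            - ((i m.succ : ℝ) - k + (m : ℕ) + 1) * bcoef k δ ((m : ℕ) + 1) := by
    intro m
    have h1 := hi.one_le m.castSucc
    have e1 : idxExt k (decUpTo k m i) m = i m.castSucc - 1 := by
      have := idxExt_coe (decUpTo k m i) m.castSucc
      simp only [Fin.val_castSucc] at this
      rw [this]
      simp [decUpTo]
    have e2 : idxExt k (decUpTo k m i) (m + 1) = i m.succ := by
      have := idxExt_coe (decUpTo k m i) m.succ
      simp only [Fin.val_succ] at this
      rw [this]
      simp [decUpTo]
    rw [idxRate, idxRate, e1, e2]
    push_cast [Nat.cast_sub h1]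
    ring
  have hite : (if i = minIdx k then tauc k δ else 0)
      = tauc k δ * (if ∀ ℓ : Fin (k + 1), i ℓ = k - (ℓ : ℕ) + 1 then (1 : ℝ) else 0) := by
    rw [mul_ite, mul_one, mul_zero]
    exact if_congr funext_iff rfl rfl
  rw [sum_range_succ, Finset.sum_range, hlast, hite, sum_congr rfl fun m _ => by rw [hterm m],
    idxRate_zero, ← hall]
  have hsum : ∑ m : Fin k, (((i m.castSucc : ℝ) - 1 - k + (m : ℕ)) * bcoef k δ (m : ℕ)
            - ((i m.succ : ℝ) - k + (m : ℕ) + 1) * bcoef k δ ((m : ℕ) + 1))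
            * p (decUpTo k (m : ℕ) i)
      = tauc k δ * ∑ m : Fin k, (((i m.castSucc : ℝ) - 1 - k + (m : ℕ)) * bcoef k δ (m : ℕ)
            - ((i m.succ : ℝ) - k + (m : ℕ) + 1) * bcoef k δ ((m : ℕ) + 1)) / tauc k δ
            * p (decUpTo k (m : ℕ) i) := by
    rw [mul_sum]
    refine sum_congr rfl fun m _ => ?_
    field_simp
  rw [hsum]
  generalize (∑ m : Fin k, (((i m.castSucc : ℝ) - 1 - k + (m : ℕ)) * bcoef k δ (m : ℕ)
            - ((i m.succ : ℝ) - k + (m : ℕ) + 1) * bcoef k δ ((m : ℕ) + 1)) / tauc k δ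
            * p (decUpTo k (m : ℕ) i)) = S at h ⊢
  generalize (if ∀ ℓ : Fin (k + 1), i ℓ = k - (ℓ : ℕ) + 1 then (1 : ℝ) else 0) = I at h ⊢
  field_simp at h
  linarith

lemma nonneg (hδ : -1 < δ) (hp : LimitRecursion k δ p) (i : Fin (k + 1) → ℕ) : 0 ≤ p i := by
  induction hn : i 0 using Nat.strong_induction_on generalizing i with
  | _ n ih =>
    by_cases hi : ValidIdx k i
    swap
    · exact (hp.1 i hi).ge
    have h := hp.rate_mul_eq hδ hi
    have hτ := tauc_pos (k := k) hδ
    have hD : 0 < tauc k δ + idxRate k δ i 0 + δ := by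
      have h1 : idxRate k δ i (k + 1) ≤ idxRate k δ i 0 := by
        have : ∀ m ≤ k + 1, idxRate k δ i m ≤ idxRate k δ i 0 := by
          intro m
          induction m with
          | zero => simp
          | succ m ihm => exact fun hm => (hi.idxRate_succ_le hδ (by omega)).trans (ihm (by omega))
        exact this _ le_rfl
      rw [idxRate_top] at h1
      linarith
    refine nonneg_of_mul_nonneg_right (b := p i) (h ▸ add_nonneg (sum_nonneg fun m hm => ?_) ?_) hD
    · by_cases hv : ValidIdx k (decUpTo k m i)
      · refine mul_nonneg (sub_nonneg.2 (hv.idxRate_succ_le hδ (by simpa [Nat.lt_succ_iff] using hm)))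
          (ih _ ?_ _ rfl)
        have := hi.one_le 0
        simp only [decUpTo, Fin.val_zero, Nat.zero_le, if_true]
        omega
      · simp [hp.1 _ hv]
    · split_ifs <;> linarith

lemma hasSum_weight (hδ : -1 < δ) (hp : LimitRecursion k δ p) (w : (Fin (k + 1) → ℕ) → ℝ)
    (hw : ∀ m ∈ range (k + 1), Summable fun i =>
      (idxRate k δ i m - idxRate k δ i (m + 1)) * p i * w (incUpTo k m i)) :
    HasSum (fun i => (tauc k δ + idxRate k δ i 0 + δ) * p i * w i)
      (∑' i, (∑ m ∈ range (k + 1),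
        (idxRate k δ i m - idxRate k δ i (m + 1)) * p i * w (incUpTo k m i))
        + tauc k δ * w (minIdx k)) := by
  classical
  rw [Summable.tsum_finsetSum hw]
  have h1 : ∀ m ∈ range (k + 1), HasSum (fun i => if ValidIdx k i then
      (idxRate k δ (decUpTo k m i) m - idxRate k δ (decUpTo k m i) (m + 1))
          * p (decUpTo k m i) * w i else 0) (∑' i,
        (idxRate k δ i m - idxRate k δ i (m + 1)) * p i * w (incUpTo k m i)) := by
    intro m hm
    rw [← (incUpTo_injective k m).hasSum_iff]
    · convert (hw m hm).hasSum using 1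
      funext i
      simp only [Function.comp, decUpTo_incUpTo]
      by_cases hi : ValidIdx k i
      · simp [hi.incUpTo m]
      · simp [hp.1 i hi]
    · intro i hi
      rw [if_neg]
      exact fun hv => hi ⟨_, hv.incUpTo_decUpTo m⟩
  have h2 := (hasSum_sum h1).add (hasSum_ite_eq (minIdx k) (tauc k δ * w (minIdx k)))
  convert h2 using 1
  funext i
  by_cases hi : ValidIdx k i
  · rw [hp.rate_mul_eq hδ hi, add_mul, sum_mul]
    congr 1
    · simp [hi]
    · split_ifs with h
      · rw [h]
      · simp
  · have : i ≠ minIdx k := fun h => hi (h ▸ minIdx_valid k)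
    simp [hi, hp.1 i hi, this]

lemma sum_rate_sub (i : Fin (k + 1) → ℕ) :
    ∑ m ∈ range (k + 1), (idxRate k δ i m - idxRate k δ i (m + 1)) = idxRate k δ i 0 + δ := by
  rw [sum_range_sub', idxRate_top]
  ring

/-- The leading degree has finite mean. -/
lemma summable_mul_idx_zero (hδ : -1 < δ) (hp : LimitRecursion k δ p) :
    Summable fun i => p i * ((i 0 : ℝ) - k) := by
  classical
  have hp0 := hp.nonneg hδ
  have hτ := tauc_pos (k := k) hδ
  have hb := bcoef_pos (k := k) hδ (Nat.zero_le k)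
  have hs : ∀ i, ValidIdx k i → (1 : ℝ) ≤ (i 0 : ℝ) - k := by
    intro i hi
    have h1 := hi.minIdx_le_idxExt (Nat.zero_le k)
    have h2 : idxExt k i 0 = i 0 := idxExt_coe i 0
    rw [h2] at h1
    have : ((k - 0 + 1 : ℕ) : ℝ) ≤ i 0 := by exact_mod_cast h1
    push_cast at this
    simp at this
    linarith
  have hterm : ∀ i, 0 ≤ p i * ((i 0 : ℝ) - k) := by
    intro i
    by_cases hi : ValidIdx k i
    · exact mul_nonneg (hp0 i) (by linarith [hs i hi])
    · simp [hp.1 i hi]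
  have hfin : ∀ (N : ℕ) (g : (Fin (k + 1) → ℕ) → ℝ), (∀ i, ¬ ValidIdx k i → g i = 0) →
      (∀ i, N < i 0 → g i = 0) → Summable g := by
    intro N g h1 h2
    refine summable_of_ne_finset_zero (s := Fintype.piFinset fun _ => range (N + 1)) fun i hi => ?_
    by_contra hne
    have hv : ValidIdx k i := by
      by_contra h
      exact hne (h1 i h)
    have hN : ¬ N < i 0 := fun h => hne (h2 i h)
    refine hi (Fintype.mem_piFinset.2 fun ℓ => ?_)
    have := hv.2.antitone (Fin.zero_le ℓ)
    simp only [mem_range]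
    omega
  set c : ℝ := min 1 (1 + δ)
  have hcpos : 0 < c := lt_min one_pos (by linarith)
  refine summable_of_sum_le (c := tauc k δ / c) hterm fun u => ?_
  set N := u.sup fun i => i 0
  set w : (Fin (k + 1) → ℕ) → ℝ := fun i => if i 0 ≤ N then (i 0 : ℝ) - k else 0 with hw
  have hinc0 : ∀ m i, incUpTo k m i 0 = i 0 + 1 := by
    intro m i
    simp [incUpTo]
  have hsw : ∀ m ∈ range (k + 1), Summable fun i =>
      (idxRate k δ i m - idxRate k δ i (m + 1)) * p i * w (incUpTo k m i) := by
    intro m _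
    refine hfin N _ (fun i hi => by simp [hp.1 i hi]) (fun i hi => ?_)
    rw [hw]
    simp only [hinc0]
    rw [if_neg (by omega), mul_zero]
  have key := hp.hasSum_weight hδ w hsw
  have hT := (summable_sum hsw).hasSum
  have hsub := key.sub hT
  have hwmin : w (minIdx k) ≤ 1 := by
    have : minIdx k 0 = k + 1 := by simp [minIdx]
    simp only [hw, this]
    split_ifs
    · push_cast
      linarith
    · exact zero_le_one
  have hle : ∀ i, (if i 0 ≤ N then c * (p i * ((i 0 : ℝ) - k)) else 0) ≤
      (tauc k δ + idxRate k δ i 0 + δ) * p i * w i - ∑ m ∈ range (k + 1),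
        (idxRate k δ i m - idxRate k δ i (m + 1)) * p i * w (incUpTo k m i) := by
    intro i
    by_cases hi : ValidIdx k i
    swap
    · simp [hp.1 i hi]
    have e : ∑ m ∈ range (k + 1),
        (idxRate k δ i m - idxRate k δ i (m + 1)) * p i * w (incUpTo k m i)
        = (idxRate k δ i 0 + δ) * p i * (if i 0 + 1 ≤ N then (i 0 : ℝ) + 1 - k else 0) := by
      rw [← sum_rate_sub, sum_mul, sum_mul]
      refine sum_congr rfl fun m _ => ?_
      simp only [hw, hinc0]
      push_cast
      rfl
    rw [e, idxRate_zero]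
    simp only [hw]
    have hpi := hp0 i
    have hsi := hs i hi
    generalize hs' : (i 0 : ℝ) - k = s at hsi ⊢
    have hs2 : (i 0 : ℝ) + 1 - k = s + 1 := by rw [← hs']; ring
    rw [hs2]
    have hbδ : 0 ≤ bcoef k δ 0 + δ := by
      unfold bcoef
      push_cast
      nlinarith [mul_nonneg (Nat.cast_nonneg (α := ℝ) k) (by linarith : 0 ≤ 1 + δ)]
    have hD : 0 ≤ s * bcoef k δ 0 + δ := by nlinarith
    have hcs : c * s ≤ s * (1 + δ) - δ := by
      have h1 : c ≤ 1 := min_le_left _ _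
      have h2 : c ≤ 1 + δ := min_le_right _ _
      nlinarith
    have main : c * (p i * s) ≤ (tauc k δ + s * bcoef k δ 0 + δ) * p i * s
        - (s * bcoef k δ 0 + δ) * p i * (s + 1) := by
      rw [tauc_eq]
      nlinarith [mul_le_mul_of_nonneg_left hcs hpi]
    have hnn : 0 ≤ (s * bcoef k δ 0 + δ) * p i * (s + 1) :=
      mul_nonneg (mul_nonneg hD hpi) (by linarith)
    by_cases h1 : i 0 ≤ N
    · rw [if_pos h1, if_pos h1]
      split_ifs
      · exact main
      · linarith
    · rw [if_neg h1, if_neg h1, if_neg (by omega)]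
      simp
  have hsl : Summable fun i => if i 0 ≤ N then c * (p i * ((i 0 : ℝ) - k)) else 0 :=
    hfin N _ (fun i hi => by simp [hp.1 i hi]) (fun i hi => if_neg (by omega))
  have h3 := hasSum_le hle hsl.hasSum hsub
  have h4 : ∑ i ∈ u, c * (p i * ((i 0 : ℝ) - k)) ≤
      ∑' i : Fin (k + 1) → ℕ, if i 0 ≤ N then c * (p i * ((i 0 : ℝ) - k)) else 0 := by
    refine le_trans (le_of_eq (sum_congr rfl fun i hi => ?_)) (hsl.sum_le_tsum u fun i _ => ?_)
    · rw [if_pos]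
      exact le_sup (f := fun i : Fin (k + 1) → ℕ => i 0) hi
    · split_ifs
      · exact mul_nonneg hcpos.le (hterm i)
      · exact le_rfl
  rw [← mul_sum] at h4
  rw [le_div_iff₀ hcpos]
  nlinarith

end LimitRecursion

/-- The coordinates of the characteristic curve of the first-order linear equation satisfied by
the probability generating function; the curve starts at `x` for `z = 1`. -/
def charPt (k : ℕ) (δ : ℝ) (x : ℕ → ℝ) (z : ℝ) : ℕ → ℝ
  | 0 => x 0 / Hfun k δ x z 0
  | m + 1 => x (m + 1) * Hfun k δ x z m ^ (bcoef k δ (m + 1) / bcoef k δ m)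
      / Hfun k δ x z (m + 1)

/-- The product of the first `n` coordinates of the characteristic curve. -/
def charProd (k : ℕ) (δ : ℝ) (x : ℕ → ℝ) (z : ℝ) (n : ℕ) : ℝ := ∏ l ∈ range n, charPt k δ x z l

section Characteristics

variable {k : ℕ} {δ : ℝ} {x : ℕ → ℝ} {z : ℝ}

lemma one_le_Hfun (hδ : -1 < δ) (hx : ∀ m, x m ∈ Set.Icc (0 : ℝ) 1) (hz : 1 ≤ z) {m : ℕ}
    (hm : m ≤ k) : 1 ≤ Hfun k δ x z m := by
  have hb := fun {m : ℕ} (hm : m ≤ k) => bcoef_pos (δ := δ) hδ hm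
  induction m with
  | zero =>
    rw [Hfun]
    nlinarith [mul_nonneg (sub_nonneg.2 hz) (sub_nonneg.2 (hx 0).2)]
  | succ m ih =>
    have h1 := Real.one_le_rpow hz (div_pos (hb hm) (hb (Nat.zero_le k))).le
    have h2 := Real.one_le_rpow (ih (by omega)) (div_pos (hb hm) (hb (by omega : m ≤ k))).le
    rw [Hfun]
    nlinarith [mul_nonneg (sub_nonneg.2 h1) (sub_nonneg.2 (hx (m + 1)).2),
      mul_nonneg (sub_nonneg.2 h2) (hx (m + 1)).1]

lemma charPt_mem_Icc (hδ : -1 < δ) (hx : ∀ m, x m ∈ Set.Icc (0 : ℝ) 1) (hz : 1 ≤ z) {m : ℕ}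
    (hm : m ≤ k) : charPt k δ x z m ∈ Set.Icc (0 : ℝ) 1 := by
  have hH := one_le_Hfun hδ hx hz hm
  cases m with
  | zero =>
    exact ⟨div_nonneg (hx 0).1 (by linarith), div_le_one_of_le₀ ((hx 0).2.trans hH) (by linarith)⟩
  | succ m =>
    have hH' := one_le_Hfun hδ hx hz (by omega : m ≤ k)
    refine ⟨div_nonneg (mul_nonneg (hx _).1 (Real.rpow_nonneg (by linarith) _)) (by linarith),
      div_le_one_of_le₀ ?_ (by linarith)⟩
    have := mul_nonneg (sub_nonneg.2 (hx (m + 1)).2)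
      (Real.rpow_nonneg (by linarith : 0 ≤ z) (bcoef k δ (m + 1) / bcoef k δ 0))
    rw [Hfun]
    linarith

lemma charProd_zero : charProd k δ x z 0 = 1 := by simp [charProd]

lemma charProd_succ (n : ℕ) :
    charProd k δ x z (n + 1) = charProd k δ x z n * charPt k δ x z n := by
  simp [charProd, prod_range_succ]

lemma charProd_mem_Icc (hδ : -1 < δ) (hx : ∀ m, x m ∈ Set.Icc (0 : ℝ) 1) (hz : 1 ≤ z) {n : ℕ}
    (hn : n ≤ k + 1) : charProd k δ x z n ∈ Set.Icc (0 : ℝ) 1 := by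
  have h := fun l (hl : l ∈ range n) =>
    charPt_mem_Icc (k := k) hδ hx hz (m := l) (by have := mem_range.1 hl; omega)
  exact ⟨prod_nonneg fun l hl => (h l hl).1, prod_le_one (fun l hl => (h l hl).1)
    fun l hl => (h l hl).2⟩

lemma charProd_succ_le (hδ : -1 < δ) (hx : ∀ m, x m ∈ Set.Icc (0 : ℝ) 1) (hz : 1 ≤ z) {n : ℕ}
    (hn : n ≤ k) : charProd k δ x z (n + 1) ≤ charProd k δ x z n := by
  rw [charProd_succ]
  exact mul_le_of_le_one_right (charProd_mem_Icc hδ hx hz (by omega)).1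
    (charPt_mem_Icc hδ hx hz hn).2

lemma Hfun_at_one (m : ℕ) : Hfun k δ x 1 m = 1 := by
  induction m with
  | zero => simp [Hfun]
  | succ m ih => simp [Hfun, ih]

lemma charPt_at_one (m : ℕ) : charPt k δ x 1 m = x m := by
  cases m <;> simp [charPt, Hfun_at_one]

lemma hasDerivAt_rpow_of_log {f : ℝ → ℝ} {a : ℝ} (hf : HasDerivAt f (f z * a) z) (h0 : 0 < f z)
    (r : ℝ) : HasDerivAt (fun z => f z ^ r) (f z ^ r * (r * a)) z := by
  refine (hf.rpow_const (p := r) (Or.inl h0.ne')).congr_deriv ?_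
  rw [Real.rpow_sub_one h0.ne']
  field_simp

lemma hasDerivAt_pow_of_log {f : ℝ → ℝ} {a : ℝ} (hf : HasDerivAt f (f z * a) z) (n : ℕ) :
    HasDerivAt (fun z => f z ^ n) (f z ^ n * (n * a)) z := by
  refine (hf.fun_pow n).congr_deriv ?_
  cases n with
  | zero => simp
  | succ n =>
    rw [Nat.add_sub_cancel]
    ring

lemma hasDerivAt_prod_of_log {ι : Type*} (s : Finset ι) {g : ι → ℝ → ℝ} {a : ι → ℝ}
    (h : ∀ m ∈ s, HasDerivAt (g m) (g m z * a m) z) :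
    HasDerivAt (fun z => ∏ m ∈ s, g m z) ((∏ m ∈ s, g m z) * ∑ m ∈ s, a m) z := by
  classical
  induction s using Finset.induction_on with
  | empty => simpa using hasDerivAt_const z (1 : ℝ)
  | insert m s hm ih =>
    simp only [prod_insert hm, sum_insert hm]
    refine ((h m (mem_insert_self m s)).fun_mul
      (ih fun n hn => h n (mem_insert_of_mem hn))).congr_deriv ?_
    ring

lemma hasDerivAt_Hfun (hδ : -1 < δ) (hx : ∀ m, x m ∈ Set.Icc (0 : ℝ) 1) (hz : 1 ≤ z) {m : ℕ}
    (hm : m ≤ k) : HasDerivAt (fun z => Hfun k δ x z m)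
      (Hfun k δ x z m * (bcoef k δ m * (1 - charProd k δ x z (m + 1)) / (bcoef k δ 0 * z))) z := by
  have hz0 : 0 < z := by linarith
  have hb0 := bcoef_pos (δ := δ) hδ (Nat.zero_le k)
  have hH := one_le_Hfun hδ hx hz hm
  induction m with
  | zero =>
    have : HasDerivAt (fun z => x 0 + z * (1 - x 0)) (1 - x 0) z := by
      simpa using ((hasDerivAt_id z).mul_const (1 - x 0)).const_add (x 0)
    simp only [Hfun]
    refine this.congr_deriv ?_
    rw [charProd_succ, charProd_zero, charPt]
    simp only [Hfun] at hH ⊢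
    obtain ⟨H, hHz⟩ : ∃ H, H = x 0 + z * (1 - x 0) := ⟨_, rfl⟩
    rw [← hHz] at hH ⊢
    field_simp
    linarith
  | succ m ih =>
    have hH' := one_le_Hfun hδ hx hz (by omega : m ≤ k)
    have hbm := bcoef_pos (δ := δ) hδ (by omega : m ≤ k)
    have h1 := hasDerivAt_rpow_of_log (ih (by omega) hH') (by linarith)
      (bcoef k δ (m + 1) / bcoef k δ m)
    have h2 : HasDerivAt (fun z : ℝ => z ^ (bcoef k δ (m + 1) / bcoef k δ 0)) _ z :=
      hasDerivAt_rpow_of_log (f := fun z => z) (a := 1 / z)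
        ((hasDerivAt_id' z).congr_deriv (by field_simp)) hz0 _
    have h3 := (h2.const_mul (1 - x (m + 1))).fun_add (h1.const_mul (x (m + 1)))
    simp only [Hfun]
    refine h3.congr_deriv ?_
    have hP : charProd k δ x z (m + 1 + 1) * Hfun k δ x z (m + 1) = charProd k δ x z (m + 1)
        * (x (m + 1) * Hfun k δ x z m ^ (bcoef k δ (m + 1) / bcoef k δ m)) := by
      rw [charProd_succ, charPt]
      have : Hfun k δ x z (m + 1) ≠ 0 := by linarith
      field_simp
    have hP' := hP
    rw [Hfun] at hP'
    generalize charProd k δ x z (m + 1 + 1) = Q at *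
    generalize charProd k δ x z (m + 1) = P at *
    generalize Hfun k δ x z m ^ (bcoef k δ (m + 1) / bcoef k δ m) = A at *
    generalize z ^ (bcoef k δ (m + 1) / bcoef k δ 0) = B at *
    field_simp
    linear_combination bcoef k δ (m + 1) * hP'

lemma hasDerivAt_charPt (hδ : -1 < δ) (hx : ∀ m, x m ∈ Set.Icc (0 : ℝ) 1) (hz : 1 ≤ z) {m : ℕ}
    (hm : m ≤ k) : HasDerivAt (fun z => charPt k δ x z m)
      (charPt k δ x z m * (bcoef k δ m * (charProd k δ x z (m + 1) - charProd k δ x z m)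
        / (bcoef k δ 0 * z))) z := by
  have hz0 : 0 < z := by linarith
  have hb0 := bcoef_pos (δ := δ) hδ (Nat.zero_le k)
  have hH := one_le_Hfun hδ hx hz hm
  have hD := hasDerivAt_Hfun hδ hx hz hm
  have hH0 : Hfun k δ x z m ≠ 0 := by linarith
  cases m with
  | zero =>
    have h := (hasDerivAt_const z (x 0)).fun_div hD hH0
    simp only [charPt]
    refine h.congr_deriv ?_
    rw [charProd_zero]
    field_simp
    ring
  | succ m =>
    have hH' := one_le_Hfun hδ hx hz (by omega : m ≤ k)
    have hbm := bcoef_pos (δ := δ) hδ (by omega : m ≤ k)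
    have h1 := hasDerivAt_rpow_of_log (hasDerivAt_Hfun hδ hx hz (by omega : m ≤ k)) (by linarith)
      (bcoef k δ (m + 1) / bcoef k δ m)
    have h := (h1.const_mul (x (m + 1))).fun_div hD hH0
    simp only [charPt]
    refine h.congr_deriv ?_
    generalize Hfun k δ x z m ^ (bcoef k δ (m + 1) / bcoef k δ m) = A at *
    field_simp
    ring

/-- The monomial `Π_m y_m^{i_m - (k - m + 1)}` along the characteristic curve `y`. -/
def charMonomial (k : ℕ) (δ : ℝ) (x : ℕ → ℝ) (z : ℝ) (i : Fin (k + 1) → ℕ) : ℝ :=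
  ∏ m ∈ range (k + 1), charPt k δ x z m ^ (idxExt k i m - (k - m + 1))

/-- The integrating factor along the characteristic curve. -/
def charWeight (k : ℕ) (δ : ℝ) (x : ℕ → ℝ) (z : ℝ) : ℝ :=
  z ^ (-(tauc k δ / bcoef k δ 0)) *
    ∏ m ∈ range (k + 1), Hfun k δ x z m ^ (-((1 + δ) / bcoef k δ m))

/-- Up to sign and the factor `b_0 z`, the logarithmic derivative of
`charWeight * charMonomial`. -/
def charRate (k : ℕ) (δ : ℝ) (x : ℕ → ℝ) (z : ℝ) (i : Fin (k + 1) → ℕ) : ℝ :=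
  tauc k δ + idxRate k δ i 0 + δ - ∑ m ∈ range (k + 1),
    (idxRate k δ i m - idxRate k δ i (m + 1)) * charProd k δ x z (m + 1)

lemma charMonomial_mem_Icc (hδ : -1 < δ) (hx : ∀ m, x m ∈ Set.Icc (0 : ℝ) 1) (hz : 1 ≤ z)
    (i : Fin (k + 1) → ℕ) : charMonomial k δ x z i ∈ Set.Icc (0 : ℝ) 1 := by
  have h := fun l (hl : l ∈ range (k + 1)) =>
    charPt_mem_Icc (k := k) hδ hx hz (m := l) (by have := mem_range.1 hl; omega)
  exact ⟨prod_nonneg fun l hl => pow_nonneg (h l hl).1 _, prod_le_one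
    (fun l hl => pow_nonneg (h l hl).1 _) fun l hl => pow_le_one₀ (h l hl).1 (h l hl).2⟩

lemma charMonomial_minIdx : charMonomial k δ x z (minIdx k) = 1 := by
  refine prod_eq_one fun m hm => ?_
  rw [idxExt, dif_pos (mem_range.1 hm)]
  simp [minIdx]

lemma charMonomial_incUpTo {i : Fin (k + 1) → ℕ} (hi : ValidIdx k i) {m : ℕ} (hm : m ≤ k) :
    charMonomial k δ x z (incUpTo k m i) = charProd k δ x z (m + 1) * charMonomial k δ x z i := by
  have h1 : charProd k δ x z (m + 1)
      = ∏ l ∈ range (k + 1), charPt k δ x z l ^ (if l ≤ m then 1 else 0) := by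
    rw [charProd, ← prod_subset (range_subset_range.2 (by omega : m + 1 ≤ k + 1))]
    · refine prod_congr rfl fun l hl => ?_
      rw [if_pos (by have := mem_range.1 hl; omega), pow_one]
    · intro l _ hl
      rw [if_neg (by have := mt mem_range.2 hl; omega), pow_zero]
  rw [h1, charMonomial, charMonomial, ← prod_mul_distrib]
  refine prod_congr rfl fun l hl => ?_
  have hl' := mem_range.1 hl
  rw [← pow_add]
  congr 1
  have h2 := hi.minIdx_le_idxExt (by omega : l ≤ k)
  rw [idxExt, dif_pos hl'] at h2 ⊢
  rw [idxExt, dif_pos hl']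
  simp only [incUpTo]
  split_ifs <;> omega

lemma charWeight_mem_Icc (hδ : -1 < δ) (hx : ∀ m, x m ∈ Set.Icc (0 : ℝ) 1) (hz : 1 ≤ z) :
    charWeight k δ x z ∈ Set.Icc 0 (z ^ (-(tauc k δ / bcoef k δ 0))) := by
  have h : ∀ m ∈ range (k + 1), Hfun k δ x z m ^ (-((1 + δ) / bcoef k δ m)) ∈ Set.Icc (0 : ℝ) 1 := by
    intro m hm
    have hm' : m ≤ k := by have := mem_range.1 hm; omega
    have hH := one_le_Hfun hδ hx hz hm'
    exact ⟨Real.rpow_nonneg (by linarith) _, Real.rpow_le_one_of_one_le_of_nonpos hH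
      (neg_nonpos.2 (div_nonneg (by linarith) (bcoef_pos hδ hm').le))⟩
  have hzr := Real.rpow_nonneg (by linarith : 0 ≤ z) (-(tauc k δ / bcoef k δ 0))
  exact ⟨mul_nonneg hzr (prod_nonneg fun m hm => (h m hm).1),
    mul_le_of_le_one_right hzr (prod_le_one (fun m hm => (h m hm).1) fun m hm => (h m hm).2)⟩

lemma charRate_nonneg (hδ : -1 < δ) (hx : ∀ m, x m ∈ Set.Icc (0 : ℝ) 1) (hz : 1 ≤ z)
    {i : Fin (k + 1) → ℕ} (hi : ValidIdx k i) : 0 ≤ charRate k δ x z i := by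
  have : ∑ m ∈ range (k + 1), (idxRate k δ i m - idxRate k δ i (m + 1)) * charProd k δ x z (m + 1)
      ≤ ∑ m ∈ range (k + 1), (idxRate k δ i m - idxRate k δ i (m + 1)) :=
    sum_le_sum fun m hm => mul_le_of_le_one_right
      (sub_nonneg.2 (hi.idxRate_succ_le hδ (by have := mem_range.1 hm; omega)))
      (charProd_mem_Icc hδ hx hz (by have := mem_range.1 hm; omega)).2
  rw [LimitRecursion.sum_rate_sub] at this
  have := tauc_pos (k := k) hδ
  unfold charRate
  linarith

lemma sum_sub_mul_sub (P : ℕ → ℝ) (n : ℕ) :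
    ∑ m ∈ range n, ((n : ℝ) - m) * (P m - P (m + 1)) = ∑ m ∈ range n, (P 0 - P (m + 1)) := by
  induction n with
  | zero => simp
  | succ n ih =>
    rw [sum_range_succ, sum_range_succ, ← ih]
    have h : ∑ m ∈ range n, (((n + 1 : ℕ) : ℝ) - m) * (P m - P (m + 1))
        = ∑ m ∈ range n, ((n : ℝ) - m) * (P m - P (m + 1)) + ∑ m ∈ range n, (P m - P (m + 1)) := by
      rw [← sum_add_distrib]
      refine sum_congr rfl fun m _ => ?_
      push_cast
      ring
    rw [h, sum_range_sub']
    push_cast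
    ring

lemma sum_sub_mul_eq (c P : ℕ → ℝ) (n : ℕ) :
    ∑ m ∈ range n, (c m - c (m + 1)) * P (m + 1)
      = c 0 * P 0 - c n * P n - ∑ m ∈ range n, c m * (P m - P (m + 1)) := by
  induction n with
  | zero => simp
  | succ n ih =>
    rw [sum_range_succ, sum_range_succ, ih]
    ring

lemma charRate_eq {i : Fin (k + 1) → ℕ} (hi : ValidIdx k i) :
    charRate k δ x z i = tauc k δ + ∑ m ∈ range (k + 1), ((1 + δ) * (1 - charProd k δ x z (m + 1))
      + ((idxExt k i m - (k - m + 1) : ℕ) : ℝ)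
        * (bcoef k δ m * (charProd k δ x z m - charProd k δ x z (m + 1)))) := by
  have h1 := sum_sub_mul_sub (charProd k δ x z) (k + 1)
  have h2 := sum_sub_mul_eq (idxRate k δ i) (charProd k δ x z) (k + 1)
  have h3 := sum_range_sub' (charProd k δ x z) (k + 1)
  rw [charRate, h2, idxRate_top, charProd_zero]
  rw [charProd_zero] at h1 h3
  have h4 : ∑ m ∈ range (k + 1), ((idxExt k i m - (k - m + 1) : ℕ) : ℝ)
        * (bcoef k δ m * (charProd k δ x z m - charProd k δ x z (m + 1)))
      = ∑ m ∈ range (k + 1), idxRate k δ i m * (charProd k δ x z m - charProd k δ x z (m + 1))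
        - (1 + δ) * ∑ m ∈ range (k + 1), (((k + 1 : ℕ) : ℝ) - m)
          * (charProd k δ x z m - charProd k δ x z (m + 1))
        + δ * ∑ m ∈ range (k + 1), (charProd k δ x z m - charProd k δ x z (m + 1)) := by
    rw [mul_sum, mul_sum, ← sum_sub_distrib, ← sum_add_distrib]
    refine sum_congr rfl fun m hm => ?_
    have hm' : m ≤ k := by have := mem_range.1 hm; omega
    rw [Nat.cast_sub (hi.minIdx_le_idxExt hm'), idxRate]
    push_cast [Nat.cast_sub hm']
    unfold bcoef
    ring
  rw [sum_add_distrib, h4, ← mul_sum, h1, h3]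
  ring

lemma hasDerivAt_charWeight_mul_charMonomial (hδ : -1 < δ) (hx : ∀ m, x m ∈ Set.Icc (0 : ℝ) 1)
    (hz : 1 ≤ z) {i : Fin (k + 1) → ℕ} (hi : ValidIdx k i) :
    HasDerivAt (fun z => charWeight k δ x z * charMonomial k δ x z i)
      (-(charWeight k δ x z * charMonomial k δ x z i * charRate k δ x z i / (bcoef k δ 0 * z)))
      z := by
  have hz0 : 0 < z := by linarith
  have hb0 := bcoef_pos (δ := δ) hδ (Nat.zero_le k)
  have h1 : HasDerivAt (fun z : ℝ => z ^ (-(tauc k δ / bcoef k δ 0))) _ z :=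
    hasDerivAt_rpow_of_log (f := fun z => z) (a := 1 / z)
      ((hasDerivAt_id' z).congr_deriv (by field_simp)) hz0 _
  have h2 := hasDerivAt_prod_of_log (range (k + 1)) (z := z) fun m hm =>
    hasDerivAt_rpow_of_log (hasDerivAt_Hfun hδ hx hz (Nat.lt_succ_iff.1 (mem_range.1 hm)))
      (zero_lt_one.trans_le (one_le_Hfun hδ hx hz (Nat.lt_succ_iff.1 (mem_range.1 hm))))
      (-((1 + δ) / bcoef k δ m))
  have h3 := hasDerivAt_prod_of_log (range (k + 1)) (z := z) fun m hm =>
    hasDerivAt_pow_of_log (hasDerivAt_charPt hδ hx hz (Nat.lt_succ_iff.1 (mem_range.1 hm)))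
      (idxExt k i m - (k - m + 1))
  have h := (h1.fun_mul h2).fun_mul h3
  simp only [charWeight, charMonomial]
  refine h.congr_deriv ?_
  have hS : charRate k δ x z i / (bcoef k δ 0 * z) = tauc k δ / bcoef k δ 0 * (1 / z)
      - ∑ m ∈ range (k + 1), -((1 + δ) / bcoef k δ m)
        * (bcoef k δ m * (1 - charProd k δ x z (m + 1)) / (bcoef k δ 0 * z))
      - ∑ m ∈ range (k + 1), ((idxExt k i m - (k - m + 1) : ℕ) : ℝ)
        * (bcoef k δ m * (charProd k δ x z (m + 1) - charProd k δ x z m)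
          / (bcoef k δ 0 * z)) := by
    rw [charRate_eq hi, add_div, sum_div, sub_sub, ← sum_add_distrib, sub_eq_add_neg,
      ← sum_neg_distrib]
    congr 1
    · field_simp
    · refine sum_congr rfl fun m hm => ?_
      have := bcoef_pos (δ := δ) hδ (Nat.lt_succ_iff.1 (mem_range.1 hm))
      field_simp
      ring
  rw [mul_div_assoc, hS]
  ring

lemma tendsto_charWeight_mul_charMonomial (hδ : -1 < δ) (hx : ∀ m, x m ∈ Set.Icc (0 : ℝ) 1)
    (i : Fin (k + 1) → ℕ) :
    Tendsto (fun z => charWeight k δ x z * charMonomial k δ x z i) atTop (nhds 0) := by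
  have h := tendsto_rpow_neg_atTop (div_pos (tauc_pos (k := k) hδ) (bcoef_pos hδ (Nat.zero_le k)))
  refine tendsto_of_tendsto_of_tendsto_of_le_of_le' tendsto_const_nhds h ?_ ?_
  all_goals
    filter_upwards [eventually_ge_atTop (1 : ℝ)] with z hz
    have h1 := charWeight_mem_Icc (k := k) hδ hx hz
    have h2 := charMonomial_mem_Icc hδ hx hz i
  · exact mul_nonneg h1.1 h2.1
  · exact (mul_le_of_le_one_right h1.1 h2.2).trans h1.2

lemma charWeight_at_one : charWeight k δ x 1 = 1 := by
  simp [charWeight, Hfun_at_one]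

/-- The differential equation for the generating function, in summed form along the
characteristic curve. -/
lemma LimitRecursion.hasSum_charRate {p : (Fin (k + 1) → ℕ) → ℝ} (hδ : -1 < δ)
    (hp : LimitRecursion k δ p) (hx : ∀ m, x m ∈ Set.Icc (0 : ℝ) 1) (hz : 1 ≤ z) :
    HasSum (fun i => p i * (charMonomial k δ x z i * charRate k δ x z i)) (tauc k δ) := by
  have hp0 := hp.nonneg hδ
  have hmono : ∀ m ∈ range (k + 1), ∀ i,
      (idxRate k δ i m - idxRate k δ i (m + 1)) * p i * charMonomial k δ x z (incUpTo k m i)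
      = (idxRate k δ i m - idxRate k δ i (m + 1)) * charProd k δ x z (m + 1)
        * (p i * charMonomial k δ x z i) := by
    intro m hm i
    by_cases hi : ValidIdx k i
    · rw [charMonomial_incUpTo hi (Nat.lt_succ_iff.1 (mem_range.1 hm))]
      ring
    · simp [hp.1 i hi]
  have hs : ∀ m ∈ range (k + 1), Summable fun i =>
      (idxRate k δ i m - idxRate k δ i (m + 1)) * p i * charMonomial k δ x z (incUpTo k m i) := by
    intro m hm
    have hS := (hp.summable_mul_idx_zero hδ).mul_left (bcoef k δ 0 + |δ|)
    refine Summable.of_nonneg_of_le (fun i => ?_) (fun i => ?_) hS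
    all_goals
      by_cases hi : ValidIdx k i
      swap
      · simp [hp.1 i hi]
      have hA : ∀ m ∈ range (k + 1), 0 ≤ idxRate k δ i m - idxRate k δ i (m + 1) := fun m hm =>
        sub_nonneg.2 (hi.idxRate_succ_le hδ (Nat.lt_succ_iff.1 (mem_range.1 hm)))
      have hM := charMonomial_mem_Icc hδ hx hz (incUpTo k m i)
    · exact mul_nonneg (mul_nonneg (hA m hm) (hp0 i)) hM.1
    · have h1 : idxRate k δ i m - idxRate k δ i (m + 1) ≤ idxRate k δ i 0 + δ := by
        rw [← sum_rate_sub]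
        exact single_le_sum hA hm
      have h2 : (1 : ℝ) ≤ i 0 - k := by
        have h := hi.minIdx_le_idxExt (Nat.zero_le k)
        have e : idxExt k i 0 = i 0 := idxExt_coe i 0
        rw [e, Nat.sub_zero] at h
        have : ((k + 1 : ℕ) : ℝ) ≤ i 0 := by exact_mod_cast h
        push_cast at this
        linarith
      rw [idxRate_zero] at h1
      have h3 : idxRate k δ i m - idxRate k δ i (m + 1)
          ≤ (bcoef k δ 0 + |δ|) * ((i 0 : ℝ) - k) := by
        nlinarith [le_abs_self δ, abs_nonneg δ]
      calc _ ≤ (idxRate k δ i m - idxRate k δ i (m + 1)) * p i :=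
            mul_le_of_le_one_right (mul_nonneg (hA m hm) (hp0 i)) hM.2
        _ ≤ (bcoef k δ 0 + |δ|) * ((i 0 : ℝ) - k) * p i := mul_le_mul_of_nonneg_right h3 (hp0 i)
        _ = _ := by ring
  have h := (hp.hasSum_weight hδ _ hs).sub (summable_sum hs).hasSum
  rw [charMonomial_minIdx, add_sub_cancel_left, mul_one] at h
  refine (congrArg (HasSum · (tauc k δ)) (funext fun i => ?_)).mp h
  rw [sum_congr rfl fun m hm => hmono m hm i, ← sum_mul, charRate]
  ring

end Characteristics

lemma extVec_coe {k : ℕ} (x : Fin (k + 1) → ℝ) (ℓ : Fin (k + 1)) : extVec k x ℓ = x ℓ :=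
  dif_pos ℓ.2

lemma extVec_mem_Icc {k : ℕ} {x : Fin (k + 1) → ℝ} (hx : ∀ ℓ, x ℓ ∈ Set.Icc (0 : ℝ) 1) (m : ℕ) :
    extVec k x m ∈ Set.Icc (0 : ℝ) 1 := by
  unfold extVec
  split_ifs
  · exact hx _
  · simp

lemma prod_pow_eq_mul_charMonomial (k : ℕ) (δ : ℝ) (x : Fin (k + 1) → ℝ) {i : Fin (k + 1) → ℕ}
    (hi : ValidIdx k i) : ∏ ℓ, x ℓ ^ i ℓ
      = (∏ m : Fin (k + 1), x m ^ (k - (m : ℕ) + 1)) * charMonomial k δ (extVec k x) 1 i := by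
  rw [charMonomial, Finset.prod_range, ← prod_mul_distrib]
  refine prod_congr rfl fun ℓ _ => ?_
  have h := hi.minIdx_le_idxExt (Nat.lt_succ_iff.1 ℓ.2)
  rw [charPt_at_one, extVec_coe, ← pow_add, Nat.add_sub_cancel' h, idxExt_coe]

/-- The integral representation of the joint probability generating function of the limiting
degree distribution:
`φ(x_0,…,x_k) = Π_m x_m^{k-m+1} ∫_1^∞ (τ/b_0) z^{-(1+τ/b_0)} (x_0(1-z)+z)^{-(1+δ)/b_0}
  Π_{m=1}^k H_m(x_0,…,x_m,z)^{-(1+δ)/b_m} dz`. -/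
theorem pgf_integral_representation (k : ℕ) (δ : ℝ) (hδ : -1 < δ)
    (p : (Fin (k + 1) → ℕ) → ℝ) (hp : LimitRecursion k δ p)
    (x : Fin (k + 1) → ℝ) (hx : ∀ ℓ, x ℓ ∈ Set.Icc (0 : ℝ) 1) :
    pgfFun k p x
      = (∏ m : Fin (k + 1), x m ^ (k - (m : ℕ) + 1)) *
        ∫ z in Set.Ioi (1 : ℝ),
          (tauc k δ / bcoef k δ 0) * z ^ (-(1 + tauc k δ / bcoef k δ 0)) *
            (x 0 * (1 - z) + z) ^ (-((1 + δ) / bcoef k δ 0)) *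
            ∏ m : Fin k,
              Hfun k δ (extVec k x) z ((m : ℕ) + 1)
                ^ (-((1 + δ) / bcoef k δ ((m : ℕ) + 1))) := by
  have hX := extVec_mem_Icc hx
  set X := extVec k x
  have hp0 := hp.nonneg hδ
  have hb0 := bcoef_pos (k := k) hδ (Nat.zero_le k)
  set F : (Fin (k + 1) → ℕ) → ℝ → ℝ := fun i z =>
    p i * -(charWeight k δ X z * charMonomial k δ X z i * charRate k δ X z i
      / (bcoef k δ 0 * z)) with hF
  have hneg : ∀ i, ValidIdx k i → ∀ z ∈ Set.Ioi (1 : ℝ), -(charWeight k δ X z *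
      charMonomial k δ X z i * charRate k δ X z i / (bcoef k δ 0 * z)) ≤ 0 := by
    intro i hi z hz
    have hz1 : 1 ≤ z := le_of_lt hz
    exact neg_nonpos.2 (div_nonneg (mul_nonneg (mul_nonneg (charWeight_mem_Icc hδ hX hz1).1
      (charMonomial_mem_Icc hδ hX hz1 i).1) (charRate_nonneg hδ hX hz1 hi))
      (mul_nonneg hb0.le (by linarith)))
  have hderiv := fun i (hi : ValidIdx k i) z (hz : z ∈ Set.Ici (1 : ℝ)) =>
    hasDerivAt_charWeight_mul_charMonomial hδ hX hz hi
  have hint : ∀ i, IntegrableOn (F i) (Set.Ioi 1) := by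
    intro i
    by_cases hi : ValidIdx k i
    · exact (integrableOn_Ioi_deriv_of_nonpos' (hderiv i hi) (hneg i hi)
        (tendsto_charWeight_mul_charMonomial hδ hX i)).const_mul _
    · simp [hF, hp.1 i hi]
  have hval : ∀ i, ∫ z in Set.Ioi 1, F i z = -(p i * charMonomial k δ X 1 i) := by
    intro i
    by_cases hi : ValidIdx k i
    · simp only [hF]
      rw [integral_const_mul, integral_Ioi_of_hasDerivAt_of_nonpos' (hderiv i hi) (hneg i hi)
        (tendsto_charWeight_mul_charMonomial hδ hX i), charWeight_at_one]
      ring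
    · simp [hF, hp.1 i hi]
  have hnorm : ∀ i, ∫ z in Set.Ioi 1, ‖F i z‖ = p i * charMonomial k δ X 1 i := by
    intro i
    rw [← neg_neg (p i * _), ← hval, ← integral_neg]
    refine setIntegral_congr_fun measurableSet_Ioi fun z hz => ?_
    by_cases hi : ValidIdx k i
    · exact Real.norm_of_nonpos (mul_nonpos_of_nonneg_of_nonpos (hp0 i) (hneg i hi z hz))
    · simp [hF, hp.1 i hi]
  have hsum : Summable fun i => p i * charMonomial k δ X 1 i := by
    refine Summable.of_nonneg_of_le
      (fun i => mul_nonneg (hp0 i) (charMonomial_mem_Icc hδ hX le_rfl i).1) (fun i => ?_)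
      (hp.summable_mul_idx_zero hδ)
    by_cases hi : ValidIdx k i
    · have h := hi.minIdx_le_idxExt (Nat.zero_le k)
      have e : idxExt k i 0 = i 0 := idxExt_coe i 0
      rw [e, Nat.sub_zero] at h
      have h' : ((k + 1 : ℕ) : ℝ) ≤ i 0 := by exact_mod_cast h
      push_cast at h'
      exact mul_le_mul_of_nonneg_left
        ((charMonomial_mem_Icc hδ hX le_rfl i).2.trans (by linarith)) (hp0 i)
    · simp [hp.1 i hi]
  have hmain := hasSum_integral_of_summable_integral_norm hint (by simpa only [hnorm] using hsum)
  have hpgf : pgfFun k p x = (∏ m : Fin (k + 1), x m ^ (k - (m : ℕ) + 1)) *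
      ∑' i, p i * charMonomial k δ X 1 i := by
    rw [pgfFun, ← tsum_mul_left]
    refine tsum_congr fun i => ?_
    by_cases hi : ValidIdx k i
    · rw [prod_pow_eq_mul_charMonomial k δ x hi]
      ring
    · simp [hp.1 i hi]
  rw [hpgf]
  congr 1
  rw [← neg_inj, ← tsum_neg, ← tsum_congr hval, hmain.tsum_eq, ← integral_neg]
  refine setIntegral_congr_fun measurableSet_Ioi fun z hz => ?_
  have hz1 : 1 ≤ z := le_of_lt hz
  have hz0 : 0 < z := by linarith
  have hODE := (hp.hasSum_charRate hδ hX hz1).mul_left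
    (-(charWeight k δ X z / (bcoef k δ 0 * z)))
  have hFz : ∀ i, F i z = -(charWeight k δ X z / (bcoef k δ 0 * z)) *
      (p i * (charMonomial k δ X z i * charRate k δ X z i)) := by
    intro i
    simp only [hF]
    ring
  have hX0 : X 0 = x 0 := extVec_coe x 0
  have hH0 : x 0 * (1 - z) + z = Hfun k δ X z 0 := by
    rw [Hfun, hX0]
    ring
  rw [tsum_congr hFz, hODE.tsum_eq, hH0, charWeight, prod_range_succ', Finset.prod_range,
    neg_add, Real.rpow_add hz0, Real.rpow_neg_one]
  field_simp
end
end

section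
/- For every integer k ≥ 0, real δ > -1 and every i ≥ k+1, the marginal expected degree counts m̃^{(0)}_n(i) := E[Σ_{1≤i_k<⋯<i_1<i} N_n(i, i_1, …, i_k)] satisfy m̃^{(0)}_n(i)/(1+(n+1)(k+1)) → p̃^{(0)}_i as n → ∞, where (p̃^{(0)}_i)_{i≥k+1} is the unique solution of the recursion p̃^{(0)}_i = (((i−k−1)b_0+δ)/((i−k)b_0+(k+2)(1+δ))) p̃^{(0)}_{i−1} + (τ/(b_0+(k+2)(1+δ))) 1{i = k+1} for i ≥ k+1 (with p̃^{(0)}_k := 0). -/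
open MeasureTheory Filter Finset

noncomputable section

instance : MeasurableSpace (Finset ℕ) := ⊤
instance : MeasurableSpace (Finset (Finset ℕ)) := ⊤

/-- The `m`-degree of an `m`-simplex `s` in the simplicial complex `g`: the number of
`(m+1)`-simplices (i.e. sets of cardinality `m+2`) of `g` containing `s`. -/
def simDeg (m : ℕ) (g : Finset (Finset ℕ)) (s : Finset ℕ) : ℕ :=
  (g.filter fun t => s ⊆ t ∧ t.card = m + 2).card

/-- The initial complex: one `(k+1)`-simplex on the vertex set `{1, …, k+2}` together
with all its (nonempty) subsimplices. -/
def initComplex (k : ℕ) : Finset (Finset ℕ) :=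
  (Finset.Icc 1 (k + 2)).powerset.filter fun s => s.Nonempty

/-- Add to `g` the simplex `s ∪ {v}` together with all of its (nonempty) subsimplices. -/
def addSimplex (g : Finset (Finset ℕ)) (s : Finset ℕ) (v : ℕ) : Finset (Finset ℕ) :=
  g ∪ (insert v s).powerset.filter fun t => t.Nonempty

/-- The set of `k`-simplices (sets of cardinality `k+1`) of the complex `g`. -/
def kSimplices (k : ℕ) (g : Finset (Finset ℕ)) : Finset (Finset ℕ) :=
  g.filter fun s => s.card = k + 1

/-- The preferential attachment simplicial complex with parameters `k` and `δ`:
`G n ω` is the complex at time `n`, `choice n ω` is the `k`-simplex selected by the vertex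
arriving at time `n ≥ 1`, chosen among the `k`-simplices of `G (n-1)` with conditional
probability proportional to its `k`-degree plus `δ`. -/
structure PAComplex (k : ℕ) (δ : ℝ) (Ω : Type*) [MeasurableSpace Ω] where
  μ : Measure Ω
  isProb : IsProbabilityMeasure μ
  G : ℕ → Ω → Finset (Finset ℕ)
  choice : ℕ → Ω → Finset ℕ
  meas_G : ∀ n, Measurable (G n)
  meas_choice : ∀ n, Measurable (choice n)
  init : ∀ ω, G 0 ω = initComplex k
  choice_mem : ∀ n ω, 1 ≤ n → choice n ω ∈ kSimplices k (G (n - 1) ω)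
  step : ∀ n ω, 1 ≤ n → G n ω = addSimplex (G (n - 1) ω) (choice n ω) (n + k + 2)
  cond_law : ∀ n : ℕ, 1 ≤ n → ∀ g : ℕ → Finset (Finset ℕ),
    ∀ s ∈ kSimplices k (g (n - 1)),
      μ {ω | choice n ω = s ∧ ∀ j < n, G j ω = g j}
        = ENNReal.ofReal (((simDeg k (g (n - 1)) s : ℝ) + δ) /
            ∑ t ∈ kSimplices k (g (n - 1)), ((simDeg k (g (n - 1)) t : ℝ) + δ)) *
          μ {ω | ∀ j < n, G j ω = g j}

/-- The `c` largest vertices of the simplex `s` (so for an enumeration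
`s = {v_0 < v_1 < ⋯ < v_k}` and `c = m+1` this is the youngest `m`-simplex
`{v_{k-m}, …, v_k}`). -/
def topSub (s : Finset ℕ) (c : ℕ) : Finset ℕ :=
  s.filter fun v => (s.filter fun w => v < w).card < c

/-- `Ncount k g i` is the number of `k`-simplices `s = {v_0 < ⋯ < v_k}` of `g` such that
for each `m = 0, …, k` the `m`-degree of the youngest `m`-simplex `{v_{k-m}, …, v_k}`
equals `i m`. -/
def Ncount (k : ℕ) (g : Finset (Finset ℕ)) (i : Fin (k + 1) → ℕ) : ℕ :=
  ((kSimplices k g).filter fun s =>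
    ∀ m : Fin (k + 1), simDeg (m : ℕ) g (topSub s ((m : ℕ) + 1)) = i m).card

/-- The recursion for the limiting marginal pmf `(p̃^{(0)}_i)_{i ≥ k+1}` of the top degree. -/
def MarginalRec (k : ℕ) (δ : ℝ) (q : ℕ → ℝ) : Prop :=
  q k = 0 ∧
  ∀ i : ℕ, k + 1 ≤ i →
    q i = (((i : ℝ) - k - 1) * bcoef k δ 0 + δ) /
        (((i : ℝ) - k) * bcoef k δ 0 + ((k : ℝ) + 2) * (1 + δ)) * q (i - 1)
      + tauc k δ / (bcoef k δ 0 + ((k : ℝ) + 2) * (1 + δ)) * (if i = k + 1 then 1 else 0)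

/-- The number of `c`-element simplices of `h` containing the vertex `w`. -/
def simplexCountAt (c : ℕ) (h : Finset (Finset ℕ)) (w : ℕ) : ℕ :=
  (h.filter fun t => w ∈ t ∧ t.card = c).card

/-- The number of `k`-simplices of `h` whose youngest vertex has degree `i`. -/
def topDegCount (k : ℕ) (h : Finset (Finset ℕ)) (i : ℕ) : ℕ :=
  ((kSimplices k h).filter fun s => simDeg 0 h (topSub s 1) = i).card

/-! ### Counting subsets -/

lemma card_powerset_filter_mem {S : Finset ℕ} {w : ℕ} (hw : w ∈ S) (c : ℕ) :
    (S.powerset.filter fun u => w ∈ u ∧ u.card = c + 1).card = (S.card - 1).choose c := by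
  have h : (S.powerset.filter fun u => w ∈ u ∧ u.card = c + 1)
      = ((S.erase w).powersetCard c).image (insert w) := by
    ext u
    simp only [mem_filter, mem_powerset, mem_image, mem_powersetCard]
    constructor
    · rintro ⟨hu, hwu, hc⟩
      exact ⟨u.erase w, ⟨erase_subset_erase _ hu, by rw [card_erase_of_mem hwu, hc]; rfl⟩,
        insert_erase hwu⟩
    · rintro ⟨a, ⟨ha, hc⟩, rfl⟩
      have hwa : w ∉ a := fun h => by simpa using ha h
      refine ⟨insert_subset hw (ha.trans (erase_subset _ _)), mem_insert_self _ _, ?_⟩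
      rw [card_insert_of_notMem hwa, hc]
  rw [h, card_image_of_injOn, card_powersetCard, card_erase_of_mem hw]
  intro a ha b hb hab
  simp only [mem_coe, mem_powersetCard] at ha hb
  have hwa : w ∉ a := fun h => by simpa using ha.1 h
  have hwb : w ∉ b := fun h => by simpa using hb.1 h
  rw [← erase_insert hwa, ← erase_insert hwb, hab]

lemma card_powerset_filter_mem_eq_zero {S : Finset ℕ} {w : ℕ} (hw : w ∉ S) (c : ℕ) :
    (S.powerset.filter fun u => w ∈ u ∧ u.card = c).card = 0 := by
  rw [card_eq_zero, filter_eq_empty_iff]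
  rintro u hu ⟨hwu, -⟩
  exact hw (mem_powerset.1 hu hwu)

lemma card_powerset_filter_card (S : Finset ℕ) (c : ℕ) :
    (S.powerset.filter fun u => u.card = c).card = S.card.choose c := by
  rw [← powersetCard_eq_filter, card_powersetCard]

/-! ### Adding a simplex -/

section AddSimplex

variable {h : Finset (Finset ℕ)} {s : Finset ℕ} {v : ℕ}

lemma sum_addSimplex {M : Type*} [AddCommMonoid M] (hv : ∀ t ∈ h, v ∉ t)
    (hs : ∀ u ⊆ s, u.Nonempty → u ∈ h) (hvs : v ∉ s) (f : Finset ℕ → M) :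
    ∑ t ∈ addSimplex h s v, f t = ∑ t ∈ h, f t + ∑ u ∈ s.powerset, f (insert v u) := by
  have heq : addSimplex h s v = h ∪ s.powerset.image (insert v) := by
    ext t
    simp only [addSimplex, mem_union, mem_filter, mem_powerset, mem_image]
    constructor
    · rintro (ht | ⟨ht, hne⟩)
      · exact Or.inl ht
      · by_cases hvt : v ∈ t
        · refine Or.inr ⟨t.erase v, ?_, insert_erase hvt⟩
          rwa [← subset_insert_iff]
        · exact Or.inl (hs t ((subset_insert_iff_of_notMem hvt).1 ht) hne)
    · rintro (ht | ⟨a, ha, rfl⟩)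
      · exact Or.inl ht
      · exact Or.inr ⟨insert_subset_insert _ ha, insert_nonempty _ _⟩
  have hdisj : Disjoint h (s.powerset.image (insert v)) := by
    rw [disjoint_left]
    intro t ht ht'
    obtain ⟨a, -, rfl⟩ := mem_image.1 ht'
    exact hv _ ht (mem_insert_self _ _)
  rw [heq, sum_union hdisj, sum_image]
  intro a ha b hb hab
  have hva : v ∉ a := fun h => hvs (mem_powerset.1 ha h)
  have hvb : v ∉ b := fun h => hvs (mem_powerset.1 hb h)
  rw [← erase_insert hva, ← erase_insert hvb, hab]

lemma card_filter_addSimplex (hv : ∀ t ∈ h, v ∉ t) (hs : ∀ u ⊆ s, u.Nonempty → u ∈ h)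
    (hvs : v ∉ s) (p : Finset ℕ → Prop) [DecidablePred p] :
    ((addSimplex h s v).filter p).card
      = (h.filter p).card + (s.powerset.filter fun u => p (insert v u)).card := by
  simp only [card_filter]
  exact sum_addSimplex hv hs hvs _

lemma card_insert_of_mem_powerset (hvs : v ∉ s) {u : Finset ℕ} (hu : u ∈ s.powerset) :
    (insert v u).card = u.card + 1 :=
  card_insert_of_notMem fun h => hvs (mem_powerset.1 hu h)

lemma simplexCountAt_addSimplex_self (hv : ∀ t ∈ h, v ∉ t)
    (hs : ∀ u ⊆ s, u.Nonempty → u ∈ h) (hvs : v ∉ s) (c : ℕ) :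
    simplexCountAt (c + 1) (addSimplex h s v) v = s.card.choose c := by
  have h0 : (h.filter fun t => v ∈ t ∧ t.card = c + 1) = ∅ :=
    filter_eq_empty_iff.2 fun t ht hvt => hv t ht hvt.1
  rw [simplexCountAt, card_filter_addSimplex hv hs hvs, h0, card_empty, zero_add,
    ← card_powerset_filter_card]
  congr 1
  refine filter_congr fun u hu => ?_
  simp [card_insert_of_mem_powerset hvs hu]

lemma simplexCountAt_addSimplex_of_ne (hv : ∀ t ∈ h, v ∉ t)
    (hs : ∀ u ⊆ s, u.Nonempty → u ∈ h) (hvs : v ∉ s) {w : ℕ} (hw : w ≠ v) (c : ℕ) :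
    simplexCountAt (c + 1) (addSimplex h s v) w = simplexCountAt (c + 1) h w
      + (s.powerset.filter fun u => w ∈ u ∧ u.card = c).card := by
  rw [simplexCountAt, card_filter_addSimplex hv hs hvs, simplexCountAt]
  congr 2
  refine filter_congr fun u hu => ?_
  simp [card_insert_of_mem_powerset hvs hu, hw]

end AddSimplex

lemma simDeg_zero_singleton (h : Finset (Finset ℕ)) (w : ℕ) :
    simDeg 0 h {w} = simplexCountAt 2 h w := by
  simp [simDeg, simplexCountAt]

/-! ### Invariants of the attachment process -/

/-- The combinatorial properties shared by all complexes reachable after `n` attachments. -/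
structure AttachmentInvariant (k n : ℕ) (h : Finset (Finset ℕ)) : Prop where
  nonempty : ∀ t ∈ h, t.Nonempty
  subset_Icc : ∀ t ∈ h, t ⊆ Icc 1 (n + k + 2)
  down_closed : ∀ t ∈ h, ∀ u ⊆ t, u.Nonempty → u ∈ h
  exists_facet : ∀ t ∈ h, ∃ u ∈ h, t ⊆ u ∧ u.card = k + 2
  card_facets : (h.filter fun t => t.card = k + 2).card = n + 1
  card_kSimplices : (kSimplices k h).card = k + 2 + n * (k + 1)
  one_le_facets : ∀ w ∈ Icc 1 (n + k + 2), 1 ≤ simplexCountAt (k + 2) h w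
  edges_eq : ∀ w ∈ Icc 1 (n + k + 2), simplexCountAt 2 h w = simplexCountAt (k + 2) h w + k
  kSimplices_eq : ∀ w ∈ Icc 1 (n + k + 2),
    simplexCountAt (k + 1) h w = 1 + k * simplexCountAt (k + 2) h w

lemma simplexCountAt_initComplex {k w : ℕ} (hw : w ∈ Icc 1 (k + 2)) (c : ℕ) :
    simplexCountAt (c + 1) (initComplex k) w = (k + 1).choose c := by
  have := card_powerset_filter_mem hw c
  rw [Nat.card_Icc] at this
  rw [simplexCountAt, initComplex, filter_filter]
  refine Eq.trans ?_ this
  congr 1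
  refine filter_congr fun u _ => ?_
  constructor
  · exact fun h => h.2
  · exact fun h => ⟨⟨w, h.1⟩, h⟩

lemma card_initComplex_filter (k c : ℕ) :
    ((initComplex k).filter fun t => t.card = c + 1).card = (k + 2).choose (c + 1) := by
  have := card_powerset_filter_card (Icc 1 (k + 2)) (c + 1)
  rw [Nat.card_Icc] at this
  rw [initComplex, filter_filter]
  refine Eq.trans ?_ this
  congr 1
  refine filter_congr fun u _ => ?_
  constructor
  · exact fun h => h.2
  · exact fun h => ⟨card_pos.1 (by omega), h⟩

lemma attachmentInvariant_initComplex (k : ℕ) : AttachmentInvariant k 0 (initComplex k) where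
  nonempty t ht := (mem_filter.1 ht).2
  subset_Icc t ht := by
    have := mem_powerset.1 (mem_filter.1 ht).1
    rwa [zero_add]
  down_closed t ht u hu hne :=
    mem_filter.2 ⟨mem_powerset.2 (hu.trans (mem_powerset.1 (mem_filter.1 ht).1)), hne⟩
  exists_facet t ht :=
    ⟨Icc 1 (k + 2), mem_filter.2 ⟨mem_powerset_self _, ⟨1, by simp⟩⟩,
      mem_powerset.1 (mem_filter.1 ht).1, by simp⟩
  card_facets := by rw [card_initComplex_filter]; simp
  card_kSimplices := by
    rw [kSimplices, card_initComplex_filter, Nat.choose_succ_self_right]; simp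
  one_le_facets w hw := by
    rw [zero_add] at hw
    rw [simplexCountAt_initComplex hw]; simp
  edges_eq w hw := by
    rw [zero_add] at hw
    rw [simplexCountAt_initComplex hw, simplexCountAt_initComplex hw]; simp; ring
  kSimplices_eq w hw := by
    rw [zero_add] at hw
    rw [simplexCountAt_initComplex hw, simplexCountAt_initComplex hw]; simp; ring

namespace AttachmentInvariant

variable {k n : ℕ} {h : Finset (Finset ℕ)}

lemma new_notMem (H : AttachmentInvariant k n h) : ∀ t ∈ h, n + 1 + k + 2 ∉ t := by
  intro t ht hv
  have := mem_Icc.1 (H.subset_Icc t ht hv)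
  omega

lemma down_closed_of_mem_kSimplices (H : AttachmentInvariant k n h) {s : Finset ℕ}
    (hs : s ∈ kSimplices k h) : ∀ u ⊆ s, u.Nonempty → u ∈ h :=
  H.down_closed s (mem_filter.1 hs).1

lemma simplexCountAt_step (H : AttachmentInvariant k n h) {s : Finset ℕ}
    (hs : s ∈ kSimplices k h) {w : ℕ} (hw : w ∈ Icc 1 (n + k + 2)) (c : ℕ) :
    simplexCountAt (c + 1) (addSimplex h s (n + 1 + k + 2)) w = simplexCountAt (c + 1) h w
      + (s.powerset.filter fun u => w ∈ u ∧ u.card = c).card :=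
  simplexCountAt_addSimplex_of_ne H.new_notMem (H.down_closed_of_mem_kSimplices hs)
    (H.new_notMem s (mem_filter.1 hs).1) (by rintro rfl; simp at hw) c

lemma simplexCountAt_step_new (H : AttachmentInvariant k n h) {s : Finset ℕ}
    (hs : s ∈ kSimplices k h) (c : ℕ) :
    simplexCountAt (c + 1) (addSimplex h s (n + 1 + k + 2)) (n + 1 + k + 2)
      = (k + 1).choose c := by
  rw [simplexCountAt_addSimplex_self H.new_notMem (H.down_closed_of_mem_kSimplices hs)
    (H.new_notMem s (mem_filter.1 hs).1), (mem_filter.1 hs).2]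

lemma card_filter_step (H : AttachmentInvariant k n h) {s : Finset ℕ}
    (hs : s ∈ kSimplices k h) (c : ℕ) :
    ((addSimplex h s (n + 1 + k + 2)).filter fun t => t.card = c + 1).card
      = (h.filter fun t => t.card = c + 1).card + (k + 1).choose c := by
  have hv := H.new_notMem s (mem_filter.1 hs).1
  rw [card_filter_addSimplex H.new_notMem (H.down_closed_of_mem_kSimplices hs) hv,
    ← (mem_filter.1 hs).2, ← card_powerset_filter_card s]
  congr 2
  refine filter_congr fun u hu => ?_
  simp [card_insert_of_mem_powerset hv hu]

lemma simplexCountAt_two_step (H : AttachmentInvariant k n h) {s : Finset ℕ}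
    (hs : s ∈ kSimplices k h) {w : ℕ} (hw : w ∈ Icc 1 (n + k + 2)) :
    simplexCountAt 2 (addSimplex h s (n + 1 + k + 2)) w
      = simplexCountAt 2 h w + if w ∈ s then 1 else 0 := by
  rw [H.simplexCountAt_step hs hw 1]
  split_ifs with hws
  · rw [card_powerset_filter_mem hws 0, Nat.choose_zero_right]
  · rw [card_powerset_filter_mem_eq_zero hws]

lemma simplexCountAt_facet_step (H : AttachmentInvariant k n h) {s : Finset ℕ}
    (hs : s ∈ kSimplices k h) {w : ℕ} (hw : w ∈ Icc 1 (n + k + 2)) :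
    simplexCountAt (k + 2) (addSimplex h s (n + 1 + k + 2)) w
      = simplexCountAt (k + 2) h w + if w ∈ s then 1 else 0 := by
  rw [H.simplexCountAt_step hs hw (k + 1)]
  split_ifs with hws
  · rw [card_powerset_filter_mem hws k, (mem_filter.1 hs).2, Nat.add_sub_cancel,
      Nat.choose_self]
  · rw [card_powerset_filter_mem_eq_zero hws]

lemma simplexCountAt_kSimplex_step (H : AttachmentInvariant k n h) {s : Finset ℕ}
    (hs : s ∈ kSimplices k h) {w : ℕ} (hw : w ∈ Icc 1 (n + k + 2)) :
    simplexCountAt (k + 1) (addSimplex h s (n + 1 + k + 2)) w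
      = simplexCountAt (k + 1) h w + if w ∈ s then k else 0 := by
  rw [H.simplexCountAt_step hs hw k]
  split_ifs with hws
  · have hc := (mem_filter.1 hs).2
    cases k with
    | zero =>
      rw [Nat.add_left_cancel_iff, card_eq_zero, filter_eq_empty_iff]
      rintro u - ⟨hwu, hu0⟩
      exact notMem_empty w (card_eq_zero.1 hu0 ▸ hwu)
    | succ j =>
      rw [card_powerset_filter_mem hws j, hc, Nat.add_sub_cancel, Nat.choose_succ_self_right]
  · rw [card_powerset_filter_mem_eq_zero hws]

lemma step (H : AttachmentInvariant k n h) {s : Finset ℕ} (hs : s ∈ kSimplices k h) :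
    AttachmentInvariant k (n + 1) (addSimplex h s (n + 1 + k + 2)) := by
  have hs' := mem_filter.1 hs
  have hv := H.new_notMem s hs'.1
  have hsplit : ∀ w ∈ Icc 1 (n + 1 + k + 2), w ∈ Icc 1 (n + k + 2) ∨ w = n + 1 + k + 2 := by
    intro w hw
    rw [mem_Icc] at *
    omega
  have hmem : ∀ t, t ∈ addSimplex h s (n + 1 + k + 2) ↔
      t ∈ h ∨ t ⊆ insert (n + 1 + k + 2) s ∧ t.Nonempty := by
    simp [addSimplex]
  refine ⟨?_, ?_, ?_, ?_, ?_, ?_, ?_, ?_, ?_⟩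
  · intro t ht
    rcases (hmem t).1 ht with ht | ht
    exacts [H.nonempty t ht, ht.2]
  · have hmono : Icc 1 (n + k + 2) ⊆ Icc 1 (n + 1 + k + 2) := Icc_subset_Icc_right (by omega)
    intro t ht
    rcases (hmem t).1 ht with ht | ht
    · exact (H.subset_Icc t ht).trans hmono
    · exact ht.1.trans (insert_subset (by simp) ((H.subset_Icc s hs'.1).trans hmono))
  · intro t ht u hu hne
    rcases (hmem t).1 ht with ht | ht
    · exact (hmem u).2 (Or.inl (H.down_closed t ht u hu hne))
    · exact (hmem u).2 (Or.inr ⟨hu.trans ht.1, hne⟩)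
  · intro t ht
    rcases (hmem t).1 ht with ht | ht
    · obtain ⟨u, hu, h1, h2⟩ := H.exists_facet t ht
      exact ⟨u, (hmem u).2 (Or.inl hu), h1, h2⟩
    · exact ⟨_, (hmem _).2 (Or.inr ⟨Subset.rfl, insert_nonempty _ _⟩), ht.1,
        by rw [card_insert_of_notMem hv, hs'.2]⟩
  · rw [H.card_filter_step hs, H.card_facets, Nat.choose_self]
  · have h1 := H.card_kSimplices
    rw [kSimplices] at h1 ⊢
    rw [H.card_filter_step hs, h1, Nat.choose_succ_self_right]
    ring
  · intro w hw
    rcases hsplit w hw with hw | rfl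
    · rw [H.simplexCountAt_facet_step hs hw]
      exact (H.one_le_facets w hw).trans (Nat.le_add_right _ _)
    · rw [H.simplexCountAt_step_new hs]; simp
  · intro w hw
    rcases hsplit w hw with hw | rfl
    · rw [H.simplexCountAt_facet_step hs hw, H.simplexCountAt_two_step hs hw, H.edges_eq w hw]
      ring
    · rw [H.simplexCountAt_step_new hs, H.simplexCountAt_step_new hs]; simp; ring
  · intro w hw
    rcases hsplit w hw with hw | rfl
    · rw [H.simplexCountAt_facet_step hs hw, H.simplexCountAt_kSimplex_step hs hw,
        H.kSimplices_eq w hw]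
      split_ifs <;> ring
    · rw [H.simplexCountAt_step_new hs, H.simplexCountAt_step_new hs]; simp; ring

end AttachmentInvariant

/-! ### Youngest subsimplices -/

lemma topSub_subset (s : Finset ℕ) (c : ℕ) : topSub s c ⊆ s := filter_subset _ _

lemma topSub_mono (s : Finset ℕ) {c d : ℕ} (hcd : c ≤ d) : topSub s c ⊆ topSub s d :=
  monotone_filter_right s fun _ _ h => lt_of_lt_of_le h hcd

lemma card_topSub {s : Finset ℕ} {c : ℕ} (hc : c ≤ s.card) : (topSub s c).card = c := by
  set r : ℕ → ℕ := fun v => (s.filter fun w => v < w).card with hr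
  have hlt : ∀ a ∈ s, ∀ b ∈ s, a < b → r b < r a := by
    intro a _ b hb hab
    refine card_lt_card ⟨fun w hw => ?_, fun hsub => ?_⟩
    · rw [mem_filter] at *
      exact ⟨hw.1, hab.trans hw.2⟩
    · exact lt_irrefl b (mem_filter.1 (hsub (mem_filter.2 ⟨hb, hab⟩))).2
  have hinj : Set.InjOn r s := by
    intro a ha b hb hab
    rcases lt_trichotomy a b with h | h | h
    · exact absurd hab (hlt a ha b hb h).ne'
    · exact h
    · exact absurd hab (hlt b hb a ha h).ne
  have himg : s.image r = range s.card := by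
    refine eq_of_subset_of_card_le (fun x hx => ?_) (by rw [card_image_of_injOn hinj, card_range])
    obtain ⟨v, hv, rfl⟩ := mem_image.1 hx
    rw [mem_range]
    refine card_lt_card ⟨filter_subset _ _, fun hsub => ?_⟩
    exact lt_irrefl v (mem_filter.1 (hsub hv)).2
  have htop : (topSub s c).image r = range c := by
    have : (topSub s c).image r = (s.image r).filter (· < c) := by
      rw [filter_image]; rfl
    rw [this, himg]
    ext x
    simp only [mem_filter, mem_range]
    omega
  rw [← card_image_of_injOn (hinj.mono (topSub_subset s c)), htop, card_range]

lemma topSub_card {s : Finset ℕ} {c : ℕ} (hc : s.card = c) : topSub s c = s :=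
  eq_of_subset_of_card_le (topSub_subset s c) (by rw [card_topSub hc.ge, hc])

lemma exists_topSub_one {s : Finset ℕ} (hs : s.Nonempty) : ∃ w ∈ s, topSub s 1 = {w} := by
  obtain ⟨w, hw⟩ := card_eq_one.1 (card_topSub (card_pos.2 hs))
  exact ⟨w, topSub_subset s 1 (hw ▸ mem_singleton_self w), hw⟩

lemma topSub_one_insert {u : Finset ℕ} {v : ℕ} (hu : ∀ w ∈ u, w < v) :
    topSub (insert v u) 1 = {v} := by
  refine (eq_of_subset_of_card_le (singleton_subset_iff.2 ?_) ?_).symm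
  · refine mem_filter.2 ⟨mem_insert_self _ _, ?_⟩
    rw [Nat.lt_one_iff, card_eq_zero, filter_eq_empty_iff]
    intro w hw
    rcases mem_insert.1 hw with rfl | hw
    exacts [lt_irrefl _, (hu w hw).not_gt]
  · rw [card_topSub (card_pos.2 (insert_nonempty _ _)), card_singleton]

namespace AttachmentInvariant

variable {k n : ℕ} {h : Finset (Finset ℕ)}

/-! ### Total attachment weights -/

lemma sum_simDeg_filter (H : AttachmentInvariant k n h) (p : Finset ℕ → Prop)
    [DecidablePred p] :
    ∑ s ∈ (kSimplices k h).filter p, simDeg k h s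
      = ∑ t ∈ h.filter (fun t => t.card = k + 2),
          (t.powerset.filter fun s => p s ∧ s.card = k + 1).card := by
  have hdc := sum_card_bipartiteAbove_eq_sum_card_bipartiteBelow
    (s := (kSimplices k h).filter p) (t := h.filter fun t => t.card = k + 2)
    (fun s t : Finset ℕ => s ⊆ t)
  refine Eq.trans (sum_congr rfl fun s _ => ?_) (hdc.trans (sum_congr rfl fun t ht => ?_))
  · rw [simDeg, bipartiteAbove, filter_filter]
    simp only [and_comm]
  · congr 1
    ext s
    simp only [bipartiteBelow, kSimplices, mem_filter, mem_powerset]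
    constructor
    · rintro ⟨⟨⟨-, hc⟩, hp⟩, hst⟩
      exact ⟨hst, hp, hc⟩
    · rintro ⟨hst, hp, hc⟩
      exact ⟨⟨⟨H.down_closed t (mem_filter.1 ht).1 s hst (card_pos.1 (by omega)), hc⟩, hp⟩, hst⟩

lemma sum_simDeg (H : AttachmentInvariant k n h) :
    ∑ s ∈ kSimplices k h, simDeg k h s = (k + 2) * (n + 1) := by
  have h1 := H.sum_simDeg_filter (fun _ => True)
  simp only [filter_true, true_and] at h1
  have h2 : ∀ t ∈ h.filter (fun t => t.card = k + 2),
      (t.powerset.filter fun s => s.card = k + 1).card = k + 2 := by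
    intro t ht
    rw [card_powerset_filter_card, (mem_filter.1 ht).2, Nat.choose_succ_self_right]
  rw [h1, sum_congr rfl h2, sum_const, H.card_facets, smul_eq_mul, mul_comm]

lemma sum_simDeg_mem (H : AttachmentInvariant k n h) (w : ℕ) :
    ∑ s ∈ (kSimplices k h).filter (fun s => w ∈ s), simDeg k h s
      = (k + 1) * simplexCountAt (k + 2) h w := by
  rw [H.sum_simDeg_filter, simplexCountAt, mul_comm, ← smul_eq_mul, ← sum_const]
  have hfil : (h.filter fun t => w ∈ t ∧ t.card = k + 2)
      = (h.filter fun t => t.card = k + 2).filter (fun t => w ∈ t) := by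
    rw [filter_filter]
    simp only [and_comm]
  rw [hfil, sum_filter (fun t => w ∈ t)]
  refine sum_congr rfl fun t ht => ?_
  split_ifs with hw
  · rw [card_powerset_filter_mem hw, (mem_filter.1 ht).2, Nat.add_sub_assoc (by norm_num),
      Nat.choose_succ_self_right]
  · rw [card_powerset_filter_mem_eq_zero hw]

lemma sum_weight (H : AttachmentInvariant k n h) (δ : ℝ) :
    ∑ s ∈ kSimplices k h, ((simDeg k h s : ℝ) + δ) = n * tauc k δ + (k + 2) * (1 + δ) := by
  rw [sum_add_distrib, ← Nat.cast_sum, H.sum_simDeg, sum_const, H.card_kSimplices, nsmul_eq_mul,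
    tauc]
  push_cast
  ring

lemma simDeg_singleton (H : AttachmentInvariant k n h) {w : ℕ} (hw : w ∈ Icc 1 (n + k + 2)) :
    simDeg 0 h {w} = simplexCountAt (k + 2) h w + k := by
  rw [simDeg_zero_singleton, H.edges_eq w hw]

lemma succ_le_simDeg_singleton (H : AttachmentInvariant k n h) {w : ℕ}
    (hw : w ∈ Icc 1 (n + k + 2)) : k + 1 ≤ simDeg 0 h {w} := by
  have := H.one_le_facets w hw
  rw [H.simDeg_singleton hw]
  omega

lemma sum_weight_mem (H : AttachmentInvariant k n h) (δ : ℝ) {w : ℕ}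
    (hw : w ∈ Icc 1 (n + k + 2)) :
    ∑ s ∈ (kSimplices k h).filter (fun s => w ∈ s), ((simDeg k h s : ℝ) + δ)
      = ((simDeg 0 h {w} : ℝ) - k) * bcoef k δ 0 + δ := by
  have hc : ((kSimplices k h).filter fun s => w ∈ s).card = simplexCountAt (k + 1) h w := by
    rw [kSimplices, filter_filter, simplexCountAt]
    simp only [and_comm]
  rw [sum_add_distrib, ← Nat.cast_sum, H.sum_simDeg_mem, sum_const, hc, H.kSimplices_eq w hw,
    H.simDeg_singleton hw, nsmul_eq_mul, bcoef]
  push_cast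
  ring

/-! ### One attachment step for the degree counts -/

lemma exists_youngest (H : AttachmentInvariant k n h) {t : Finset ℕ} (ht : t ∈ h) :
    ∃ w ∈ Icc 1 (n + k + 2), topSub t 1 = {w} := by
  obtain ⟨w, hw, h1⟩ := exists_topSub_one (H.nonempty t ht)
  exact ⟨w, H.subset_Icc t ht hw, h1⟩

lemma topDegCount_eq_zero (H : AttachmentInvariant k n h) : topDegCount k h k = 0 := by
  rw [topDegCount, card_eq_zero, filter_eq_empty_iff]
  intro t ht hdeg
  obtain ⟨w, hw, h1⟩ := H.exists_youngest (mem_filter.1 ht).1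
  have := H.succ_le_simDeg_singleton hw
  rw [h1] at hdeg
  omega

lemma topDegCount_addSimplex (H : AttachmentInvariant k n h) {s : Finset ℕ}
    (hs : s ∈ kSimplices k h) (i : ℕ) :
    topDegCount k (addSimplex h s (n + 1 + k + 2)) i
      = ((kSimplices k h).filter fun t =>
          simDeg 0 h (topSub t 1) + (if topSub t 1 ⊆ s then 1 else 0) = i).card
        + if i = k + 1 then k + 1 else 0 := by
  have hs' := mem_filter.1 hs
  have hv := H.new_notMem s hs'.1
  rw [topDegCount, kSimplices, filter_filter,
    card_filter_addSimplex H.new_notMem (H.down_closed_of_mem_kSimplices hs) hv,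
    kSimplices, filter_filter]
  congr 1
  · congr 1
    refine filter_congr fun t ht => and_congr_right fun _ => ?_
    obtain ⟨w, hw, h1⟩ := H.exists_youngest ht
    simp only [h1, simDeg_zero_singleton, H.simplexCountAt_two_step hs hw,
      singleton_subset_iff]
  · have hnew : ∀ u ∈ s.powerset, ((insert (n + 1 + k + 2) u).card = k + 1 ∧
        simDeg 0 (addSimplex h s (n + 1 + k + 2)) (topSub (insert (n + 1 + k + 2) u) 1) = i)
        ↔ (u.card = k ∧ i = k + 1) := by
      intro u hu
      have hlt : ∀ w ∈ u, w < n + 1 + k + 2 := by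
        intro w hw
        have := mem_Icc.1 (H.subset_Icc s hs'.1 (mem_powerset.1 hu hw))
        omega
      rw [card_insert_of_mem_powerset hv hu, topSub_one_insert hlt, simDeg_zero_singleton,
        H.simplexCountAt_step_new hs, Nat.choose_one_right]
      omega
    rw [filter_congr hnew]
    split_ifs with hi
    · simp only [hi, and_true]
      rw [card_powerset_filter_card, hs'.2, Nat.choose_succ_self_right]
    · simp [hi]

lemma sum_weight_mul_indicator (H : AttachmentInvariant k n h) (δ : ℝ) {t : Finset ℕ}
    (ht : t ∈ h) (i : ℕ) :
    ∑ s ∈ kSimplices k h, ((simDeg k h s : ℝ) + δ) *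
        (if simDeg 0 h (topSub t 1) + (if topSub t 1 ⊆ s then 1 else 0) = i + 1
          then (1 : ℝ) else 0)
      = (((i : ℝ) - k) * bcoef k δ 0 + δ) *
          (if simDeg 0 h (topSub t 1) = i then (1 : ℝ) else 0)
        + (n * tauc k δ + (k + 2) * (1 + δ) - (((i + 1 : ℕ) : ℝ) - k) * bcoef k δ 0 - δ) *
          (if simDeg 0 h (topSub t 1) = i + 1 then (1 : ℝ) else 0) := by
  obtain ⟨w, hw, h1⟩ := H.exists_youngest ht
  rw [h1]
  simp only [singleton_subset_iff]
  have hin := H.sum_weight_mem δ hw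
  have htot := H.sum_weight δ
  rw [← sum_filter_add_sum_filter_not (kSimplices k h) (fun s => w ∈ s), hin] at htot
  rw [← sum_filter_add_sum_filter_not (kSimplices k h) (fun s => w ∈ s)]
  have e1 : ∀ s ∈ (kSimplices k h).filter (fun s => w ∈ s), ((simDeg k h s : ℝ) + δ) *
      (if simDeg 0 h {w} + (if w ∈ s then 1 else 0) = i + 1 then (1 : ℝ) else 0)
      = ((simDeg k h s : ℝ) + δ) * (if simDeg 0 h {w} = i then (1 : ℝ) else 0) := by
    intro s hs
    simp [(mem_filter.1 hs).2]
  have e2 : ∀ s ∈ (kSimplices k h).filter (fun s => w ∉ s), ((simDeg k h s : ℝ) + δ) *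
      (if simDeg 0 h {w} + (if w ∈ s then 1 else 0) = i + 1 then (1 : ℝ) else 0)
      = ((simDeg k h s : ℝ) + δ) * (if simDeg 0 h {w} = i + 1 then (1 : ℝ) else 0) := by
    intro s hs
    simp [(mem_filter.1 hs).2]
  rw [sum_congr rfl e1, sum_congr rfl e2, ← sum_mul, ← sum_mul, hin, ← htot]
  by_cases hd : simDeg 0 h {w} = i
  · simp [hd]
  · by_cases hd' : simDeg 0 h {w} = i + 1
    · simp [hd']
      ring
    · simp [hd, hd']

lemma expected_topDegCount_step (H : AttachmentInvariant k n h) {δ : ℝ}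
    (hT : (n : ℝ) * tauc k δ + (k + 2) * (1 + δ) ≠ 0) (i : ℕ) :
    ∑ s ∈ kSimplices k h,
        ((simDeg k h s : ℝ) + δ) / (∑ t ∈ kSimplices k h, ((simDeg k h t : ℝ) + δ)) *
          (topDegCount k (addSimplex h s (n + 1 + k + 2)) (i + 1) : ℝ)
      = (((i : ℝ) - k) * bcoef k δ 0 + δ) / (n * tauc k δ + (k + 2) * (1 + δ)) *
          topDegCount k h i
        + (1 - ((((i + 1 : ℕ) : ℝ) - k) * bcoef k δ 0 + δ) /
            (n * tauc k δ + (k + 2) * (1 + δ))) * topDegCount k h (i + 1)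
        + if i + 1 = k + 1 then (k : ℝ) + 1 else 0 := by
  have hcount : ∀ s ∈ kSimplices k h,
      (topDegCount k (addSimplex h s (n + 1 + k + 2)) (i + 1) : ℝ)
        = ∑ t ∈ kSimplices k h,
            (if simDeg 0 h (topSub t 1) + (if topSub t 1 ⊆ s then 1 else 0) = i + 1
              then (1 : ℝ) else 0) + if i + 1 = k + 1 then (k : ℝ) + 1 else 0 := by
    intro s hs
    rw [H.topDegCount_addSimplex hs, card_filter]
    push_cast
    rfl
  have hold : ∀ j, (topDegCount k h j : ℝ)
      = ∑ t ∈ kSimplices k h, if simDeg 0 h (topSub t 1) = j then (1 : ℝ) else 0 := by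
    intro j
    rw [topDegCount, card_filter]
    push_cast
    rfl
  have hswap : ∑ s ∈ kSimplices k h, ((simDeg k h s : ℝ) + δ) *
      ∑ t ∈ kSimplices k h,
        (if simDeg 0 h (topSub t 1) + (if topSub t 1 ⊆ s then 1 else 0) = i + 1
          then (1 : ℝ) else 0)
      = (((i : ℝ) - k) * bcoef k δ 0 + δ) * topDegCount k h i
        + (n * tauc k δ + (k + 2) * (1 + δ) - (((i + 1 : ℕ) : ℝ) - k) * bcoef k δ 0 - δ) *
          topDegCount k h (i + 1) := by
    simp only [mul_sum]
    have hin : ∀ t ∈ kSimplices k h, _ := fun t ht =>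
      H.sum_weight_mul_indicator δ (mem_filter.1 ht).1 i
    rw [sum_comm, sum_congr rfl hin, sum_add_distrib, ← mul_sum, ← mul_sum,
      ← hold, ← hold]
  have htot := H.sum_weight δ
  have hmain : ∑ s ∈ kSimplices k h, ((simDeg k h s : ℝ) + δ) *
      (topDegCount k (addSimplex h s (n + 1 + k + 2)) (i + 1) : ℝ)
      = (((i : ℝ) - k) * bcoef k δ 0 + δ) * topDegCount k h i
        + (n * tauc k δ + (k + 2) * (1 + δ) - (((i + 1 : ℕ) : ℝ) - k) * bcoef k δ 0 - δ) *
          topDegCount k h (i + 1)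
        + (n * tauc k δ + (k + 2) * (1 + δ)) * if i + 1 = k + 1 then (k : ℝ) + 1 else 0 := by
    rw [← hswap, ← htot, sum_mul, ← sum_add_distrib]
    refine sum_congr rfl fun s hs => ?_
    rw [hcount s hs, mul_add]
  rw [htot]
  simp only [div_mul_eq_mul_div]
  rw [← sum_div, hmain]
  generalize (if i + 1 = k + 1 then (k : ℝ) + 1 else 0) = e
  field_simp
  ring

/-! ### Degree vectors are automatically valid -/

lemma simDeg_lt_of_subset (H : AttachmentInvariant k n h) {m : ℕ} {a b : Finset ℕ}
    (hab : a ⊆ b) (hb : b ∈ h) (ha : a.card = m + 1) (hbc : b.card = m + 2) :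
    simDeg (m + 1) h b < simDeg m h a := by
  obtain ⟨x, hxb, hxa⟩ := exists_of_ssubset
    (ssubset_of_subset_of_ne hab (by rintro rfl; omega))
  have hinj : Set.InjOn (fun t : Finset ℕ => t.erase x)
      (h.filter fun t => b ⊆ t ∧ t.card = m + 1 + 2) := by
    intro t ht t' ht' htt
    rw [← insert_erase ((mem_filter.1 ht).2.1 hxb), ← insert_erase ((mem_filter.1 ht').2.1 hxb)]
    exact congrArg (insert x) htt
  rw [simDeg, ← card_image_of_injOn hinj, simDeg]
  refine card_lt_card ⟨fun t ht => ?_, fun hsub => ?_⟩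
  · obtain ⟨t, ht', rfl⟩ := mem_image.1 ht
    obtain ⟨hth, hbt, hc⟩ := mem_filter.1 ht'
    have hcard : (t.erase x).card = m + 2 := by
      rw [card_erase_of_mem (hbt hxb), hc]; rfl
    exact mem_filter.2 ⟨H.down_closed t hth _ (erase_subset _ _) (card_pos.1 (by omega)),
      subset_erase.2 ⟨hab.trans hbt, hxa⟩, hcard⟩
  · obtain ⟨t, -, htb⟩ := mem_image.1 (hsub (mem_filter.2 ⟨hb, hab, hbc⟩))
    have : x ∈ t.erase x := by
      change t.erase x = b at htb
      rw [htb]; exact hxb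
    simp at this

lemma validIdx_degrees (H : AttachmentInvariant k n h) {s : Finset ℕ}
    (hs : s ∈ kSimplices k h) :
    ValidIdx k fun m => simDeg (m : ℕ) h (topSub s ((m : ℕ) + 1)) := by
  obtain ⟨hsh, hsc⟩ := mem_filter.1 hs
  constructor
  · obtain ⟨u, hu, hsu, huc⟩ := H.exists_facet s hsh
    simp only [Fin.val_last]
    rw [topSub_card hsc]
    exact card_pos.2 ⟨u, mem_filter.2 ⟨hu, hsu, huc⟩⟩
  · rw [Fin.strictAnti_iff_succ_lt]
    intro m
    have hm := m.isLt
    simp only [Fin.val_succ, Fin.val_castSucc]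
    have hc1 := card_topSub (s := s) (c := (m : ℕ) + 1) (by omega)
    have hc2 := card_topSub (s := s) (c := (m : ℕ) + 1 + 1) (by omega)
    exact H.simDeg_lt_of_subset (topSub_mono s (Nat.le_succ _))
      (H.down_closed s hsh _ (topSub_subset _ _) (card_pos.1 (by omega))) hc1 hc2

lemma tsum_Ncount (H : AttachmentInvariant k n h) (i : ℕ) :
    ∑' j : {j : Fin (k + 1) → ℕ // ValidIdx k j ∧ j 0 = i}, (Ncount k h j.1 : ℝ)
      = topDegCount k h i := by
  have hsingle : ∀ s ∈ kSimplices k h,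
      HasSum (fun j : {j : Fin (k + 1) → ℕ // ValidIdx k j ∧ j 0 = i} =>
        if ∀ m : Fin (k + 1), simDeg (m : ℕ) h (topSub s ((m : ℕ) + 1)) = j.1 m
          then (1 : ℝ) else 0)
        (if simDeg 0 h (topSub s 1) = i then 1 else 0) := by
    intro s hs
    split_ifs with hi
    · have := hasSum_ite_eq
        (⟨fun m => simDeg (m : ℕ) h (topSub s ((m : ℕ) + 1)), H.validIdx_degrees hs, hi⟩ :
          {j : Fin (k + 1) → ℕ // ValidIdx k j ∧ j 0 = i}) (1 : ℝ)
      refine this.congr_fun fun j => ?_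
      congr 1
      rw [Subtype.ext_iff, funext_iff, eq_iff_iff]
      exact forall_congr' fun m => eq_comm
    · refine hasSum_zero.congr_fun fun j => if_neg fun hall => hi ?_
      rw [← j.2.2, ← hall 0]
      rfl
  have hsum := hasSum_sum hsingle
  have hN : ∀ j : {j : Fin (k + 1) → ℕ // ValidIdx k j ∧ j 0 = i}, (Ncount k h j.1 : ℝ)
      = ∑ s ∈ kSimplices k h,
        if ∀ m : Fin (k + 1), simDeg (m : ℕ) h (topSub s ((m : ℕ) + 1)) = j.1 m
          then (1 : ℝ) else 0 := by
    intro j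
    rw [Ncount, card_filter]
    push_cast
    rfl
  simp only [hN]
  rw [hsum.tsum_eq, topDegCount, card_filter]
  push_cast
  rfl

end AttachmentInvariant

/-! ### A linear recursion with vanishing step sizes -/

/-- Solutions of `x (n + 1) = (1 - a / (n τ + β)) x n + c n` with `c n → c` grow linearly. -/
lemma tendsto_div_of_linear_recursion {x c : ℕ → ℝ} {a β τ C : ℝ} (ha : 0 ≤ a) (hτ : 0 < τ)
    (hβ : 0 < β) (hc : Tendsto c atTop (nhds C))
    (hx : ∀ n : ℕ, x (n + 1) = (1 - a / (n * τ + β)) * x n + c n) :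
    Tendsto (fun n : ℕ => x n / n) atTop (nhds (C * τ / (τ + a))) := by
  set L := C * τ / (τ + a) with hL
  have hpos : ∀ n : ℕ, 0 < (n : ℝ) * τ + β := fun n => by positivity
  have hLC : L * (1 + a / τ) = C := by
    rw [hL]; field_simp
  set y : ℕ → ℝ := fun n => x n - L * (n + β / τ) with hy
  have hystep : ∀ n, y (n + 1) = (1 - a / (n * τ + β)) * y n + (c n - C) := by
    intro n
    have h1 : a / (n * τ + β) * (L * (n + β / τ)) = L * (a / τ) := by
      have := (hpos n).ne'
      field_simp
    simp only [hy]
    rw [hx n, ← hLC]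
    push_cast
    linear_combination -h1
  have hTinf : Tendsto (fun n : ℕ => (n : ℝ) * τ + β) atTop atTop :=
    tendsto_atTop_add_const_right _ _ (tendsto_natCast_atTop_atTop.atTop_mul_const hτ)
  obtain ⟨N, hN⟩ := eventually_atTop.1 (hTinf.eventually_ge_atTop a)
  have hstep : ∀ n ≥ N, |y (n + 1)| ≤ |y n| + |c n - C| := by
    intro n hn
    have hle : a / (n * τ + β) ≤ 1 := (div_le_one (hpos n)).2 (hN n hn)
    have hnn : 0 ≤ a / (n * τ + β) := div_nonneg ha (hpos n).le
    rw [hystep n]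
    refine (abs_add_le _ _).trans (add_le_add ?_ le_rfl)
    rw [abs_mul, abs_of_nonneg (by linarith : 0 ≤ 1 - a / (n * τ + β))]
    exact mul_le_of_le_one_left (abs_nonneg _) (by linarith)
  have hbound : ∀ n ≥ N, |y n| ≤ |y N| + ∑ j ∈ range n, |c j - C| := by
    intro n hn
    induction n, hn using Nat.le_induction with
    | base => exact le_add_of_nonneg_right (sum_nonneg fun _ _ => abs_nonneg _)
    | succ n hn ih =>
      rw [sum_range_succ]
      linarith [hstep n hn]
  have hces : Tendsto (fun n : ℕ => (n : ℝ)⁻¹ * ∑ j ∈ range n, |c j - C|) atTop (nhds 0) := by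
    refine Tendsto.cesaro ?_
    simpa using (hc.sub_const C).abs
  have hinv : Tendsto (fun n : ℕ => (n : ℝ)⁻¹) atTop (nhds 0) := tendsto_inv_atTop_nhds_zero_nat
  have hmaj : Tendsto (fun n : ℕ => (n : ℝ)⁻¹ * |y N|
      + (n : ℝ)⁻¹ * ∑ j ∈ range n, |c j - C|) atTop (nhds 0) := by
    simpa using (hinv.mul_const |y N|).add hces
  have hy0 : Tendsto (fun n : ℕ => (n : ℝ)⁻¹ * y n) atTop (nhds 0) := by
    refine squeeze_zero_norm' (eventually_atTop.2 ⟨N, fun n hn => ?_⟩) hmaj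
    rw [norm_mul, ← mul_add, Real.norm_eq_abs, Real.norm_eq_abs, abs_of_nonneg (by positivity)]
    exact mul_le_mul_of_nonneg_left (hbound n hn) (by positivity)
  have hlim : Tendsto (fun n : ℕ => (n : ℝ)⁻¹ * y n + (L + L * (β / τ) * (n : ℝ)⁻¹)) atTop
      (nhds L) := by
    simpa using hy0.add ((hinv.const_mul (L * (β / τ))).const_add L)
  refine hlim.congr' (eventually_atTop.2 ⟨1, fun n hn => ?_⟩)
  have : (n : ℝ) ≠ 0 := by positivity
  simp only [hy]
  field_simp
  ring

/-- If `x n / n → l` then `x n / (n τ + β) → l / τ`. -/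
lemma tendsto_div_affine {x : ℕ → ℝ} {l τ : ℝ} (β : ℝ) (hτ : τ ≠ 0)
    (hx : Tendsto (fun n : ℕ => x n / n) atTop (nhds l)) :
    Tendsto (fun n : ℕ => x n / (n * τ + β)) atTop (nhds (l / τ)) := by
  have hinv : Tendsto (fun n : ℕ => (n : ℝ)⁻¹) atTop (nhds 0) := tendsto_inv_atTop_nhds_zero_nat
  have hden : Tendsto (fun n : ℕ => τ + β * (n : ℝ)⁻¹) atTop (nhds τ) := by
    simpa using (hinv.const_mul β).const_add τ
  refine (hx.div hden hτ).congr' (eventually_atTop.2 ⟨1, fun n hn => ?_⟩)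
  have : (n : ℝ) ≠ 0 := by positivity
  simp only [Pi.div_apply]
  rw [div_div, mul_add, mul_left_comm, mul_inv_cancel₀ this, mul_one]

/-! ### The law of one attachment -/

namespace PAComplex

variable {k : ℕ} {δ : ℝ} {Ω : Type*} [MeasurableSpace Ω] (M : PAComplex k δ Ω)

instance : IsProbabilityMeasure M.μ := M.isProb

lemma choice_succ_mem (n : ℕ) (ω : Ω) : M.choice (n + 1) ω ∈ kSimplices k (M.G n ω) :=
  M.choice_mem (n + 1) ω (Nat.le_add_left _ _)

lemma G_succ (n : ℕ) (ω : Ω) :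
    M.G (n + 1) ω = addSimplex (M.G n ω) (M.choice (n + 1) ω) (n + 1 + k + 2) :=
  M.step (n + 1) ω (Nat.le_add_left _ _)

lemma invariant (n : ℕ) (ω : Ω) : AttachmentInvariant k n (M.G n ω) := by
  induction n with
  | zero => rw [M.init ω]; exact attachmentInvariant_initComplex k
  | succ n ih => rw [M.G_succ n ω]; exact ih.step (M.choice_succ_mem n ω)

/-- The complex at time `j` is recovered from any later complex by discarding newer vertices. -/
lemma filter_G {j n : ℕ} (hjn : j ≤ n) (ω : Ω) :
    (M.G n ω).filter (fun t => t ⊆ Icc 1 (j + k + 2)) = M.G j ω := by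
  induction n, hjn using Nat.le_induction with
  | base => exact filter_true_of_mem (M.invariant j ω).subset_Icc
  | succ n hn ih =>
    have H := M.invariant n ω
    have hs := M.choice_succ_mem n ω
    rw [← ih, M.G_succ n ω]
    ext t
    simp only [addSimplex, mem_filter, mem_union, mem_powerset]
    constructor
    · rintro ⟨ht | ⟨hts, hne⟩, htI⟩
      · exact ⟨ht, htI⟩
      · refine ⟨H.down_closed_of_mem_kSimplices hs t ?_ hne, htI⟩
        refine (subset_insert_iff_of_notMem fun hv => ?_).1 hts
        have := mem_Icc.1 (htI hv)
        omega
    · rintro ⟨ht, htI⟩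
      exact ⟨Or.inl ht, htI⟩

lemma measurableSet_G_eq (n : ℕ) (h : Finset (Finset ℕ)) : MeasurableSet {ω | M.G n ω = h} :=
  M.meas_G n (MeasurableSpace.measurableSet_top (s := {h}))

lemma measurableSet_choice_eq (n : ℕ) (s : Finset ℕ) : MeasurableSet {ω | M.choice n ω = s} :=
  M.meas_choice n (MeasurableSpace.measurableSet_top (s := {s}))

lemma weight_nonneg (hδ : -1 < δ) {n : ℕ} {h : Finset (Finset ℕ)}
    (H : AttachmentInvariant k n h) {s : Finset ℕ} (hs : s ∈ kSimplices k h) :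
    0 ≤ (simDeg k h s : ℝ) + δ := by
  obtain ⟨u, hu, hsu, huc⟩ := H.exists_facet s (mem_filter.1 hs).1
  have h1 : 1 ≤ simDeg k h s := card_pos.2 ⟨u, mem_filter.2 ⟨hu, hsu, huc⟩⟩
  have : (1 : ℝ) ≤ simDeg k h s := by exact_mod_cast h1
  linarith

/-- The choice law conditionally on the current complex only. -/
lemma measureReal_choice_eq (hδ : -1 < δ) (n : ℕ) (h : Finset (Finset ℕ)) {s : Finset ℕ}
    (hs : s ∈ kSimplices k h) :
    M.μ.real {ω | M.choice (n + 1) ω = s ∧ M.G n ω = h}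
      = ((simDeg k h s : ℝ) + δ) / (∑ t ∈ kSimplices k h, ((simDeg k h t : ℝ) + δ)) *
        M.μ.real {ω | M.G n ω = h} := by
  by_cases hex : ∃ ω₀, M.G n ω₀ = h
  · obtain ⟨ω₀, rfl⟩ := hex
    have hhist : ∀ ω, (∀ j < n + 1, M.G j ω = M.G j ω₀) ↔ M.G n ω = M.G n ω₀ := by
      refine fun ω => ⟨fun hall => hall n n.lt_succ_self, fun heq j hj => ?_⟩
      rw [← M.filter_G (Nat.le_of_lt_succ hj) ω, heq, M.filter_G (Nat.le_of_lt_succ hj) ω₀]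
    have hlaw := M.cond_law (n + 1) (Nat.le_add_left _ _) (fun j => M.G j ω₀) s hs
    simp only [hhist, Nat.add_sub_cancel] at hlaw
    have H := M.invariant n ω₀
    rw [measureReal_def, hlaw, ENNReal.toReal_mul, ENNReal.toReal_ofReal, measureReal_def]
    exact div_nonneg (weight_nonneg hδ H hs) (sum_nonneg fun t ht => weight_nonneg hδ H ht)
  · have h1 : {ω | M.G n ω = h} = ∅ := Set.eq_empty_of_forall_notMem fun ω hω => hex ⟨ω, hω⟩
    have h2 : {ω | M.choice (n + 1) ω = s ∧ M.G n ω = h} = ∅ :=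
      Set.eq_empty_of_forall_notMem fun ω hω => hex ⟨ω, hω.2⟩
    rw [h1, h2, measureReal_empty, mul_zero]

lemma G_mem_powerset (n : ℕ) (ω : Ω) : M.G n ω ∈ (Icc 1 (n + k + 2)).powerset.powerset :=
  mem_powerset.2 fun t ht => mem_powerset.2 ((M.invariant n ω).subset_Icc t ht)

lemma integrable_comp_G (n : ℕ) (f : Finset (Finset ℕ) → ℝ) :
    Integrable (fun ω => f (M.G n ω)) M.μ := by
  refine Integrable.of_bound (C := ∑ h ∈ (Icc 1 (n + k + 2)).powerset.powerset, |f h|)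
    (measurable_from_top.comp (M.meas_G n)).aestronglyMeasurable (ae_of_all _ fun ω => ?_)
  exact single_le_sum (f := fun h => |f h|) (fun _ _ => abs_nonneg _) (M.G_mem_powerset n ω)

lemma integral_comp_G (n : ℕ) (f : Finset (Finset ℕ) → ℝ) :
    ∫ ω, f (M.G n ω) ∂M.μ
      = ∑ h ∈ (Icc 1 (n + k + 2)).powerset.powerset, M.μ.real {ω | M.G n ω = h} * f h := by
  have hpt : ∀ ω, f (M.G n ω) = ∑ h ∈ (Icc 1 (n + k + 2)).powerset.powerset,
      {ω | M.G n ω = h}.indicator (fun _ => f h) ω := by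
    intro ω
    simp only [Set.indicator_apply, Set.mem_ofPred_eq]
    rw [sum_ite_eq, if_pos (M.G_mem_powerset n ω)]
  simp only [hpt]
  rw [integral_finsetSum _ fun h _ =>
    (integrable_const _).indicator (M.measurableSet_G_eq n h)]
  refine sum_congr rfl fun h _ => ?_
  rw [integral_indicator_const _ (M.measurableSet_G_eq n h), smul_eq_mul]

lemma integral_comp_choice (hδ : -1 < δ) (n : ℕ) (f : Finset (Finset ℕ) → Finset ℕ → ℝ) :
    ∫ ω, f (M.G n ω) (M.choice (n + 1) ω) ∂M.μ
      = ∫ ω, ∑ s ∈ kSimplices k (M.G n ω), ((simDeg k (M.G n ω) s : ℝ) + δ) /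
          (∑ t ∈ kSimplices k (M.G n ω), ((simDeg k (M.G n ω) t : ℝ) + δ)) *
            f (M.G n ω) s ∂M.μ := by
  rw [M.integral_comp_G n fun h => ∑ s ∈ kSimplices k h, ((simDeg k h s : ℝ) + δ) /
    (∑ t ∈ kSimplices k h, ((simDeg k h t : ℝ) + δ)) * f h s]
  have hmeas : ∀ h s, MeasurableSet {ω | M.choice (n + 1) ω = s ∧ M.G n ω = h} := fun h s =>
    (M.measurableSet_choice_eq (n + 1) s).inter (M.measurableSet_G_eq n h)
  have hpt : ∀ ω, f (M.G n ω) (M.choice (n + 1) ω)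
      = ∑ h ∈ (Icc 1 (n + k + 2)).powerset.powerset, ∑ s ∈ kSimplices k h,
        {ω | M.choice (n + 1) ω = s ∧ M.G n ω = h}.indicator (fun _ => f h s) ω := by
    intro ω
    rw [sum_eq_single_of_mem _ (M.G_mem_powerset n ω),
      sum_eq_single_of_mem _ (M.choice_succ_mem n ω)]
    · rw [Set.indicator_of_mem]
      exact ⟨rfl, rfl⟩
    · exact fun s _ hs => Set.indicator_of_notMem (fun hω => hs hω.1.symm) _
    · exact fun h _ hh => sum_eq_zero fun s _ =>
        Set.indicator_of_notMem (fun hω => hh hω.2.symm) _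
  simp only [hpt]
  rw [integral_finsetSum _ fun h _ => integrable_finsetSum _ fun s _ =>
    (integrable_const _).indicator (hmeas h s)]
  refine sum_congr rfl fun h _ => ?_
  rw [integral_finsetSum _ fun s _ => (integrable_const _).indicator (hmeas h s), mul_sum]
  refine sum_congr rfl fun s hs => ?_
  rw [integral_indicator_const _ (hmeas h s), smul_eq_mul, M.measureReal_choice_eq hδ n h hs]
  ring

/-! ### Expected degree counts -/

/-- The expected number of `k`-simplices at time `n` whose youngest vertex has degree `i`. -/
def expectedCount (n i : ℕ) : ℝ := ∫ ω, (topDegCount k (M.G n ω) i : ℝ) ∂M.μ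

lemma expectedCount_self (n : ℕ) : M.expectedCount n k = 0 := by
  simp [expectedCount, (M.invariant n _).topDegCount_eq_zero]

lemma expectedCount_succ (hδ : -1 < δ) (n i : ℕ)
    (hT : (n : ℝ) * tauc k δ + (k + 2) * (1 + δ) ≠ 0) :
    M.expectedCount (n + 1) (i + 1)
      = (1 - ((((i + 1 : ℕ) : ℝ) - k) * bcoef k δ 0 + δ) /
            (n * tauc k δ + (k + 2) * (1 + δ))) * M.expectedCount n (i + 1)
        + ((((i : ℝ) - k) * bcoef k δ 0 + δ) *
            (M.expectedCount n i / (n * tauc k δ + (k + 2) * (1 + δ)))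
          + if i + 1 = k + 1 then (k : ℝ) + 1 else 0) := by
  have hint : ∀ j, Integrable (fun ω => (topDegCount k (M.G n ω) j : ℝ)) M.μ := fun j =>
    M.integrable_comp_G n fun h => (topDegCount k h j : ℝ)
  simp only [expectedCount, M.G_succ n]
  rw [M.integral_comp_choice hδ n fun h s =>
    (topDegCount k (addSimplex h s (n + 1 + k + 2)) (i + 1) : ℝ)]
  simp only [(M.invariant n _).expected_topDegCount_step hT]
  generalize (((i : ℝ) - k) * bcoef k δ 0 + δ) = A
  generalize 1 - ((((i + 1 : ℕ) : ℝ) - k) * bcoef k δ 0 + δ) /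
    (n * tauc k δ + (k + 2) * (1 + δ)) = B
  generalize (n : ℝ) * tauc k δ + (k + 2) * (1 + δ) = T
  have h1 := (hint i).const_mul (A / T)
  have h2 := (hint (i + 1)).const_mul B
  have h12 : Integrable (fun ω => A / T * (topDegCount k (M.G n ω) i : ℝ)
      + B * (topDegCount k (M.G n ω) (i + 1) : ℝ)) M.μ := h1.add h2
  rw [integral_add h12 (integrable_const _), integral_add h1 h2, integral_const_mul,
    integral_const_mul, integral_const, probReal_univ, one_smul]
  ring

end PAComplex

lemma bcoef_zero_pos {k : ℕ} {δ : ℝ} (hδ : -1 < δ) : 0 < bcoef k δ 0 := by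
  have hk : (0 : ℝ) ≤ k := k.cast_nonneg
  simp only [bcoef, Nat.cast_zero]
  nlinarith

lemma tendsto_expectedCount_div {k : ℕ} {δ : ℝ} (hδ : -1 < δ) {Ω : Type*} [MeasurableSpace Ω]
    (M : PAComplex k δ Ω) {q : ℕ → ℝ} (hq : MarginalRec k δ q) {i : ℕ} (hi : k ≤ i) :
    Tendsto (fun n : ℕ => M.expectedCount n i / n) atTop (nhds ((k + 1) * q i)) := by
  have hτ := tauc_pos (k := k) hδ
  have hb := bcoef_zero_pos (k := k) hδ
  have hβ : 0 < ((k : ℝ) + 2) * (1 + δ) := mul_pos (by positivity) (by linarith)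
  have hβτ : ((k : ℝ) + 2) * (1 + δ) = tauc k δ + δ := by rw [tauc]; ring
  have hbδ : 0 < bcoef k δ 0 + δ := by
    have hk : (0 : ℝ) ≤ k := k.cast_nonneg
    simp only [bcoef, Nat.cast_zero]
    nlinarith
  induction i, hi using Nat.le_induction with
  | base => simp [M.expectedCount_self, hq.1]
  | succ i hi ih =>
    have hki : (k : ℝ) ≤ i := by exact_mod_cast hi
    have ha : 0 < (((i + 1 : ℕ) : ℝ) - k) * bcoef k δ 0 + δ := by
      push_cast
      nlinarith [mul_nonneg (sub_nonneg.2 hki) hb.le]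
    have hc := ((tendsto_div_affine (((k : ℝ) + 2) * (1 + δ)) hτ.ne' ih).const_mul
      (((i : ℝ) - k) * bcoef k δ 0 + δ)).add_const (if i + 1 = k + 1 then (k : ℝ) + 1 else 0)
    have hlim := tendsto_div_of_linear_recursion (x := fun n => M.expectedCount n (i + 1))
      ha.le hτ hβ hc fun n => M.expectedCount_succ hδ n i (by positivity)
    convert hlim using 2
    rw [hq.2 (i + 1) (by omega), Nat.add_sub_cancel]
    have hden : (((i + 1 : ℕ) : ℝ) - k) * bcoef k δ 0 + ((k : ℝ) + 2) * (1 + δ)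
        = tauc k δ + ((((i + 1 : ℕ) : ℝ) - k) * bcoef k δ 0 + δ) := by
      rw [hβτ]; ring
    have hD := (add_pos hτ ha).ne'
    rw [hden]
    split_ifs with hik
    · have hik' : i = k := by omega
      subst hik'
      have hden' : bcoef i δ 0 + ((i : ℝ) + 2) * (1 + δ)
          = tauc i δ + ((((i + 1 : ℕ) : ℝ) - i) * bcoef i δ 0 + δ) := by
        rw [hβτ]; push_cast; ring
      rw [hden', hq.1]
      simp
      field_simp
    · push_cast at *
      field_simp
      ring

/-- The normalized marginal expected degree counts
`m̃^{(0)}_n(i)/(1+(n+1)(k+1)) = E[Σ_{1 ≤ i_k < ⋯ < i_1 < i} N_n(i,i_1,…,i_k)]/(1+(n+1)(k+1))`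
converge, as `n → ∞`, to `p̃^{(0)}_i`, the solution of the marginal recursion. -/
theorem marginal_expected_degree_counts_tendsto (k : ℕ) (δ : ℝ) (hδ : -1 < δ)
    (Ω : Type*) [MeasurableSpace Ω] (M : PAComplex k δ Ω)
    (q : ℕ → ℝ) (hq : MarginalRec k δ q) (i : ℕ) (hi : k + 1 ≤ i) :
    Tendsto (fun n : ℕ =>
        (∫ ω, (∑' j : {j : Fin (k + 1) → ℕ // ValidIdx k j ∧ j 0 = i},
          (Ncount k (M.G n ω) j.1 : ℝ)) ∂M.μ) / ((1 + (n + 1) * (k + 1) : ℕ) : ℝ))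
      atTop (nhds (q i)) := by
  have hcount : ∀ n : ℕ, ∫ ω, (∑' j : {j : Fin (k + 1) → ℕ // ValidIdx k j ∧ j 0 = i},
      (Ncount k (M.G n ω) j.1 : ℝ)) ∂M.μ = M.expectedCount n i := fun n =>
    integral_congr_ae (ae_of_all _ fun ω => (M.invariant n ω).tsum_Ncount i)
  have hk : ((k : ℝ) + 1) ≠ 0 := by positivity
  have hlim := tendsto_div_affine ((k : ℝ) + 2) hk
    (tendsto_expectedCount_div hδ M hq (Nat.le_of_succ_le hi))
  rw [mul_div_cancel_left₀ _ hk] at hlim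
  refine hlim.congr fun n => ?_
  rw [hcount]
  congr 1
  push_cast
  ring
end
end
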